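/- arXiv:2507.14955 — 3 statements merged into one kernel-verified Lean document; each statement's English description precedes it below -/
import Mathlib

section
/- Let ω ⊂ ℝ³ be open, ε > 0, and let Q : ω → S₀ be a smooth solution of the Euler–Lagrange equation −ε²ΔQ − aQ − bQ² + (b/3)|Q|²I + c|Q|²Q = 0. Let φ be an admissible cutoff profile and suppose 0 ∈ ω and ρ > 0 satisfies B_{√10·ρ}(0) ⊂ ω. Then the Pohozaev-type identity holds: ∫ (2/ρ²) φ'(|y|²/ρ²) |y·∇Q(y)|² dy = ∫ e_ε(Q)(y) φ(|y|²/ρ²) dy + ∫ (2/ε²) f(Q(y)) φ(|y|²/ρ²) dy + ∫ (2|y|²/ρ²) φ'(|y|²/ρ²) e_ε(Q)(y) dy, where y·∇Q := Σ_k y_k ∂_k Q and |y·∇Q|² is its squared Frobenius norm. -/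
noncomputable section

open Matrix MeasureTheory Metric Set

attribute [local instance] Matrix.normedAddCommGroup Matrix.normedSpace

abbrev E3 : Type := EuclideanSpace ℝ (Fin 3)
abbrev M3 : Type := Matrix (Fin 3) (Fin 3) ℝ

/-- The space of symmetric traceless real 3×3 matrices. -/
def S0 : Set M3 := {Q | Q.IsSymm ∧ Q.trace = 0}

def sstar (a b c : ℝ) : ℝ := (b + Real.sqrt (b ^ 2 + 24 * a * c)) / (4 * c)

def kconst (a b c : ℝ) : ℝ :=
  sstar a b c ^ 2 / 27 * (9 * a + 2 * b * sstar a b c - 3 * c * sstar a b c ^ 2)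

/-- Bulk potential. -/
def fbulk (a b c : ℝ) (Q : M3) : ℝ :=
  kconst a b c - a / 2 * (Q * Q).trace - b / 3 * (Q * Q * Q).trace
    + c / 4 * ((Q * Q).trace) ^ 2

/-- Partial derivative `∂ₖ Q` (componentwise). -/
def pd (Q : E3 → M3) (k : Fin 3) (x : E3) : M3 :=
  Matrix.of fun i j => fderiv ℝ (fun y => Q y i j) x (EuclideanSpace.single k 1)

/-- Squared Frobenius norm of a matrix. -/
def frobSq (A : M3) : ℝ := ∑ i, ∑ j, (A i j) ^ 2

def frobNorm (A : M3) : ℝ := Real.sqrt (frobSq A)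

/-- `|∇Q|²`. -/
def gradSq (Q : E3 → M3) (x : E3) : ℝ := ∑ k : Fin 3, frobSq (pd Q k x)

/-- Energy density `e_ε(Q)`. -/
def eDen (a b c ε : ℝ) (Q : E3 → M3) (x : E3) : ℝ :=
  1 / 2 * gradSq Q x + 1 / ε ^ 2 * fbulk a b c (Q x)

/-- Energy `E_ε(Q, U)`. -/
def energy (a b c ε : ℝ) (Q : E3 → M3) (U : Set E3) : ℝ :=
  ∫ x in U, eDen a b c ε Q x

/-- Componentwise Laplacian. -/
def lapM (Q : E3 → M3) (x : E3) : M3 :=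
  ∑ k : Fin 3, Matrix.of fun i j =>
    fderiv ℝ (fun y => pd Q k y i j) x (EuclideanSpace.single k 1)

/-- `|Q|² = tr(Q²)`. -/
def normSqM (Q : M3) : ℝ := (Q * Q).trace

/-- The Euler–Lagrange equation at a point. -/
def ELeq (a b c ε : ℝ) (Q : E3 → M3) (x : E3) : Prop :=
  (-(ε ^ 2)) • lapM Q x - a • Q x - b • (Q x * Q x)
    + (b / 3 * normSqM (Q x)) • (1 : M3) + (c * normSqM (Q x)) • Q x = 0

/-- Local minimizer of the Landau–de Gennes energy on an open set `ω`. -/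
def IsLDGMin (a b c ε : ℝ) (ω : Set E3) (Q : E3 → M3) : Prop :=
  ∀ (x : E3) (r : ℝ), 0 < r → closedBall x r ⊆ ω →
    ∀ P : E3 → M3, ContDiffOn ℝ (⊤ : ℕ∞) P ω → (∀ y ∈ ω, P y ∈ S0) →
      (∃ K : Set E3, IsCompact K ∧ K ⊆ ball x r ∧ ∀ y ∉ K, P y = Q y) →
      energy a b c ε Q (ball x r) ≤ energy a b c ε P (ball x r)

/-- The vacuum manifold `N`. -/
def Nman (a b c : ℝ) : Set M3 :=
  {P | ∃ n : Fin 3 → ℝ, (∑ i, (n i) ^ 2) = 1 ∧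
    P = sstar a b c • (Matrix.vecMulVec n n - (1 / 3 : ℝ) • (1 : M3))}

/-- Frobenius distance to the vacuum manifold. -/
def distN (a b c : ℝ) (Q : M3) : ℝ :=
  sInf ((fun P => frobNorm (Q - P)) '' Nman a b c)

/-- Directional derivative `v·∇Q = Σₖ vₖ ∂ₖQ`. -/
def dirD (Q : E3 → M3) (v : E3) (x : E3) : M3 := ∑ k : Fin 3, v k • pd Q k x

/-- Admissible cutoff profile. -/
def AdmissibleCutoff (φ : ℝ → ℝ) : Prop :=
  ContDiff ℝ (⊤ : ℕ∞) φ ∧ (∀ t, 0 ≤ φ t) ∧ (∀ t, 10 ≤ t → φ t = 0) ∧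
    (∀ t ∈ Icc (0 : ℝ) 8, 1 ≤ φ t) ∧ φ 0 = 60 ∧
    (∀ t, 0 ≤ t → |deriv φ t| ≤ 100) ∧
    (∀ t ∈ Icc (0 : ℝ) 8, deriv φ t ∈ Icc (-2 : ℝ) (-1)) ∧
    (∀ t, 0 ≤ t → deriv φ t ≤ 0)

/-- The density `Θ_ρ^φ(Q, x)`. -/
def Theta (a b c ε : ℝ) (φ : ℝ → ℝ) (Q : E3 → M3) (x : E3) (ρ : ℝ) : ℝ :=
  ρ⁻¹ * ∫ y in ball x (Real.sqrt 10 * ρ), eDen a b c ε Q y * φ (‖y - x‖ ^ 2 / ρ ^ 2)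

/-- The regular scale `r(Q, x)`. -/
def regScale (a b c ε : ℝ) (Q : E3 → M3) (x : E3) : ℝ :=
  sSup {ρ : ℝ | 0 ≤ ρ ∧ ρ ≤ 1 ∧ ∀ y ∈ ball x ρ, ρ ^ 2 * eDen a b c ε Q y ≤ 1}

/-- The bad set `Bad(Q; s, δ)`. -/
def badSet (a b c ε : ℝ) (Q : E3 → M3) (s δ : ℝ) : Set E3 :=
  {y | regScale a b c ε Q y < s} ∪ {y | δ < distN a b c (Q y)}




/-- Scalar partial derivative. -/
def Dk (k : Fin 3) (g : E3 → ℝ) (x : E3) : ℝ := fderiv ℝ g x (EuclideanSpace.single k 1)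

lemma Dk_mul {k : Fin 3} {f g : E3 → ℝ} {x : E3} (hf : DifferentiableAt ℝ f x)
    (hg : DifferentiableAt ℝ g x) :
    Dk k (fun y => f y * g y) x = Dk k f x * g x + f x * Dk k g x := by
  unfold Dk
  rw [fderiv_fun_mul hf hg]
  simp
  ring

lemma Dk_add {k : Fin 3} {f g : E3 → ℝ} {x : E3} (hf : DifferentiableAt ℝ f x)
    (hg : DifferentiableAt ℝ g x) :
    Dk k (fun y => f y + g y) x = Dk k f x + Dk k g x := by
  unfold Dk
  rw [fderiv_fun_add hf hg]
  simp

lemma Dk_sub {k : Fin 3} {f g : E3 → ℝ} {x : E3} (hf : DifferentiableAt ℝ f x)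
    (hg : DifferentiableAt ℝ g x) :
    Dk k (fun y => f y - g y) x = Dk k f x - Dk k g x := by
  unfold Dk
  rw [fderiv_fun_sub hf hg]
  simp

lemma Dk_const {k : Fin 3} (r : ℝ) {x : E3} : Dk k (fun _ => r) x = 0 := by
  unfold Dk; simp

lemma Dk_sum {ι : Type} (s : Finset ι) {k : Fin 3} {f : ι → E3 → ℝ} {x : E3}
    (hf : ∀ i ∈ s, DifferentiableAt ℝ (f i) x) :
    Dk k (fun y => ∑ i ∈ s, f i y) x = ∑ i ∈ s, Dk k (f i) x := by
  unfold Dk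
  rw [fderiv_fun_sum hf]
  simp

lemma Dk_coord {k j : Fin 3} {x : E3} :
    Dk k (fun y => y j) x = if j = k then 1 else 0 := by
  unfold Dk
  have h : HasFDerivAt (fun y : E3 => y j) (EuclideanSpace.proj j : E3 →L[ℝ] ℝ) x :=
    (EuclideanSpace.proj (𝕜 := ℝ) j).hasFDerivAt
  rw [h.fderiv]
  simp

lemma hasFDerivAt_rad {ψ : ℝ → ℝ} {d : ℝ} {x : E3} (h : HasDerivAt ψ d (‖x‖ ^ 2)) :
    HasFDerivAt (fun y : E3 => ψ (‖y‖ ^ 2)) (d • ((2 : ℝ) • innerSL ℝ x)) x := by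
  have h1 : HasFDerivAt (fun y : E3 => ‖y‖ ^ 2) ((2 : ℝ) • innerSL ℝ x) x := by
    have := (hasStrictFDerivAt_norm_sq x).hasFDerivAt
    have e : (2 : ℝ) • innerSL ℝ x = 2 • innerSL ℝ x := by rw [two_smul, two_smul]
    rw [e]
    exact this
  exact h.comp_hasFDerivAt x h1

lemma Dk_rad {k : Fin 3} {ψ : ℝ → ℝ} {d : ℝ} {x : E3} (h : HasDerivAt ψ d (‖x‖ ^ 2)) :
    Dk k (fun y => ψ (‖y‖ ^ 2)) x = d * (2 * x k) := by
  unfold Dk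
  rw [(hasFDerivAt_rad h).fderiv]
  simp [EuclideanSpace.inner_single_right]

lemma Dk_congr {k : Fin 3} {f g : E3 → ℝ} {x : E3} {U : Set E3} (hU : IsOpen U) (hx : x ∈ U)
    (h : ∀ y ∈ U, f y = g y) : Dk k f x = Dk k g x := by
  unfold Dk
  rw [Filter.EventuallyEq.fderiv_eq]
  filter_upwards [hU.mem_nhds hx] with y hy using h y hy

lemma smooth_Dk {k : Fin 3} {f : E3 → ℝ} {U : Set E3} (hU : IsOpen U)
    (hf : ContDiffOn ℝ (⊤ : ℕ∞) f U) : ContDiffOn ℝ (⊤ : ℕ∞) (Dk k f) U := by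
  have h := hf.fderiv_of_isOpen (m := (⊤ : ℕ∞)) hU (by simp)
  exact h.clm_apply contDiffOn_const

lemma Dk_comm {k l : Fin 3} {f : E3 → ℝ} {U : Set E3} (hU : IsOpen U)
    (hf : ContDiffOn ℝ (⊤ : ℕ∞) f U) {x : E3} (hx : x ∈ U) :
    Dk k (Dk l f) x = Dk l (Dk k f) x := by
  have hat : ContDiffAt ℝ (⊤ : ℕ∞) f x := hf.contDiffAt (hU.mem_nhds hx)
  have hs : IsSymmSndFDerivAt ℝ f x := hat.isSymmSndFDerivAt (by
    simp only [minSmoothness_of_isRCLikeNormedField]; exact (WithTop.coe_le_coe.2 le_top : ((2 : ℕ∞) : WithTop ℕ∞) ≤ ((⊤ : ℕ∞) : WithTop ℕ∞)))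
  have hd : DifferentiableAt ℝ (fderiv ℝ f) x := by
    have h := hf.fderiv_of_isOpen (m := (⊤ : ℕ∞)) hU (by simp)
    exact (h.contDiffAt (hU.mem_nhds hx)).differentiableAt (by simp)
  have key : ∀ a b : Fin 3, Dk a (Dk b f) x =
      fderiv ℝ (fderiv ℝ f) x (EuclideanSpace.single a 1) (EuclideanSpace.single b 1) := by
    intro a b
    unfold Dk
    rw [fderiv_clm_apply hd (differentiableAt_const _)]
    simp
  rw [key, key]
  exact hs _ _

lemma sum_sq_eq (x : E3) : x 0 ^ 2 + x 1 ^ 2 + x 2 ^ 2 = ‖x‖ ^ 2 := by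
  rw [EuclideanSpace.norm_sq_eq]
  simp [Fin.sum_univ_three]

lemma div_zero_int (R r : ℝ) (hr : r < R) (X : Fin 3 → E3 → ℝ)
    (hX : ∀ j, ContDiffOn ℝ 1 (X j) (ball 0 R)) (h0 : ∀ j x, r ≤ ‖x‖ → X j x = 0)
    (g : E3 → ℝ) (hg : ∀ x ∈ ball (0 : E3) R, g x = ∑ j, Dk j (X j) x) :
    IntegrableOn g (ball 0 R) ∧ ∫ x in ball (0 : E3) R, g x = 0 := by
  have hsmooth : ∀ j, ContDiff ℝ 1 (X j) := by
    intro j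
    rw [contDiff_iff_contDiffAt]
    intro x
    by_cases hx : ‖x‖ < R
    · exact (hX j).contDiffAt (isOpen_ball.mem_nhds (by simpa using hx))
    · have : X j =ᶠ[nhds x] fun _ => 0 := by
        have ho : IsOpen {y : E3 | r < ‖y‖} := isOpen_lt continuous_const continuous_norm
        filter_upwards [ho.mem_nhds (show r < ‖x‖ by linarith)] with y hy
        exact h0 j y (le_of_lt hy)
      exact contDiffAt_const.congr_of_eventuallyEq this
  have hcs : ∀ j, HasCompactSupport (X j) := by
    intro j
    refine HasCompactSupport.intro (isCompact_closedBall (0 : E3) r) ?_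
    intro x hx
    apply h0
    simp at hx
    exact hx.le
  have hDc : ∀ j, Continuous (Dk j (X j)) := by
    intro j
    exact ((hsmooth j).continuous_fderiv (by simp)).clm_apply continuous_const
  have hDs : ∀ j, HasCompactSupport (Dk j (X j)) := by
    intro j
    have := (hcs j).fderiv (𝕜 := ℝ)
    exact this.comp_left (g := fun L : E3 →L[ℝ] ℝ => L (EuclideanSpace.single j 1)) (by simp)
  have hDi : ∀ j, Integrable (Dk j (X j)) := fun j =>
    (hDc j).integrable_of_hasCompactSupport (hDs j)
  have hI : ∀ j, ∫ x, Dk j (X j) x = 0 := by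
    intro j
    have := integral_mul_fderiv_eq_neg_fderiv_mul_of_integrable (μ := (volume : Measure E3))
      (f := fun _ => (1 : ℝ)) (g := X j) (v := EuclideanSpace.single j 1)
      (by simp) (by simp only [one_mul]; exact hDi j)
      (by simpa using (hsmooth j).continuous.integrable_of_hasCompactSupport (hcs j))
      (fun x _ => differentiableAt_const _)
      (fun x _ => (hsmooth j).differentiable (by simp) x)
    simpa [Dk] using this
  have hz : ∀ j, ∀ x ∉ ball (0 : E3) R, Dk j (X j) x = 0 := by
    intro j x hx
    have : X j =ᶠ[nhds x] fun _ => 0 := by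
      have ho : IsOpen {y : E3 | r < ‖y‖} := isOpen_lt continuous_const continuous_norm
      have : r < ‖x‖ := by simp at hx; linarith
      filter_upwards [ho.mem_nhds this] with y hy
      exact h0 j y (le_of_lt hy)
    unfold Dk
    rw [this.fderiv_eq]
    simp
  constructor
  · refine IntegrableOn.congr_fun (f := fun x => ∑ j, Dk j (X j) x) ?_ (fun x hx => (hg x hx).symm)
      measurableSet_ball
    exact (integrable_finsetSum _ (fun j _ => hDi j)).integrableOn
  · rw [setIntegral_congr_fun measurableSet_ball (fun x hx => hg x hx)]
    rw [setIntegral_eq_integral_of_forall_compl_eq_zero]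
    · rw [integral_finsetSum _ (fun j _ => hDi j)]
      simp [hI]
    · intro x hx
      exact Finset.sum_eq_zero (fun j _ => hz j x hx)


lemma contDiff_one_of {ψ ψ' : ℝ → ℝ} (h : ∀ s, HasDerivAt ψ (ψ' s) s) (hc : Continuous ψ') :
    ContDiff ℝ 1 ψ := by
  rw [contDiff_one_iff_deriv]
  refine ⟨fun s => (h s).differentiableAt, ?_⟩
  have : deriv ψ = ψ' := funext fun s => (h s).deriv
  rwa [this]

lemma contDiff_rad {ψ ψ' : ℝ → ℝ} (h : ∀ s, HasDerivAt ψ (ψ' s) s) (hc : Continuous ψ') :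
    ContDiff ℝ 1 (fun y : E3 => ψ (‖y‖ ^ 2)) :=
  (contDiff_one_of h hc).comp (contDiff_norm_sq ℝ)

lemma contDiff_coord (j : Fin 3) : ContDiff ℝ (⊤ : ℕ∞) (fun y : E3 => y j) :=
  (EuclideanSpace.proj (𝕜 := ℝ) j : E3 →L[ℝ] ℝ).contDiff

lemma le_top1 : (1 : WithTop ℕ∞) ≤ ((⊤ : ℕ∞) : WithTop ℕ∞) := by
  exact (WithTop.coe_le_coe.2 le_top : ((1 : ℕ∞) : WithTop ℕ∞) ≤ ((⊤ : ℕ∞) : WithTop ℕ∞))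

lemma diffAt_of {f : E3 → ℝ} {U : Set E3} (hU : IsOpen U)
    (hf : ContDiffOn ℝ (⊤ : ℕ∞) f U) {x : E3} (hx : x ∈ U) : DifferentiableAt ℝ f x :=
  (hf.contDiffAt (hU.mem_nhds hx)).differentiableAt (by simp)

lemma poho_pot {R r : ℝ} (hr0 : 0 ≤ r) (hr : r < R) {ψ ψ' : ℝ → ℝ}
    (h : ∀ s, HasDerivAt ψ (ψ' s) s) (hc : Continuous ψ') (hz : ∀ s, r ^ 2 ≤ s → ψ s = 0)
    {F : E3 → ℝ} (hF : ContDiffOn ℝ (⊤ : ℕ∞) F (ball 0 R)) :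
    IntegrableOn (fun x => 3 * F x * ψ (‖x‖ ^ 2) + (∑ k, x k * Dk k F x) * ψ (‖x‖ ^ 2)
        + 2 * ‖x‖ ^ 2 * ψ' (‖x‖ ^ 2) * F x) (ball 0 R) ∧
      ∫ x in ball (0 : E3) R, (3 * F x * ψ (‖x‖ ^ 2) + (∑ k, x k * Dk k F x) * ψ (‖x‖ ^ 2)
        + 2 * ‖x‖ ^ 2 * ψ' (‖x‖ ^ 2) * F x) = 0 := by
  refine div_zero_int R r hr (fun j y => y j * (F y * ψ (‖y‖ ^ 2))) ?_ ?_ _ ?_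
  · intro j
    exact ((contDiff_coord j).of_le le_top1).contDiffOn.mul
      ((hF.of_le le_top1).mul (contDiff_rad h hc).contDiffOn)
  · intro j x hx
    simp only
    rw [hz _ (by gcongr)]
    simp
  · intro x hx
    have h1 : ∀ j : Fin 3, DifferentiableAt ℝ (fun y : E3 => y j) x := fun j =>
      (contDiff_coord j).differentiable (by simp) x
    have h2 := diffAt_of isOpen_ball hF hx
    have h3 : DifferentiableAt ℝ (fun y : E3 => ψ (‖y‖ ^ 2)) x :=
      (hasFDerivAt_rad (h _)).differentiableAt
    have e : ∀ j, Dk j (fun y => y j * (F y * ψ (‖y‖ ^ 2))) x =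
        F x * ψ (‖x‖ ^ 2) + x j * (Dk j F x * ψ (‖x‖ ^ 2) + F x * (ψ' (‖x‖ ^ 2) * (2 * x j))) := by
      intro j
      rw [Dk_mul (h1 j) (h2.fun_mul h3), Dk_mul h2 h3, Dk_coord, Dk_rad (h _)]
      simp
    simp only [e]
    simp only [Fin.sum_univ_three]
    linear_combination (-2 * ψ' (‖x‖ ^ 2) * F x) * (sum_sq_eq x)

lemma poho_str {R r : ℝ} (hr0 : 0 ≤ r) (hr : r < R) {ψ ψ' : ℝ → ℝ}
    (h : ∀ s, HasDerivAt ψ (ψ' s) s) (hc : Continuous ψ') (hz : ∀ s, r ^ 2 ≤ s → ψ s = 0)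
    {v : E3 → ℝ} (hv : ContDiffOn ℝ (⊤ : ℕ∞) v (ball 0 R)) :
    IntegrableOn (fun x => (∑ j, Dk j v x ^ 2) * ψ (‖x‖ ^ 2)
        + (∑ k, x k * ∑ l, Dk l v x * Dk k (Dk l v) x) * ψ (‖x‖ ^ 2)
        + (∑ k, x k * Dk k v x) * (∑ j, Dk j (Dk j v) x) * ψ (‖x‖ ^ 2)
        + 2 * ψ' (‖x‖ ^ 2) * (∑ k, x k * Dk k v x) ^ 2) (ball 0 R) ∧
      ∫ x in ball (0 : E3) R, ((∑ j, Dk j v x ^ 2) * ψ (‖x‖ ^ 2)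
        + (∑ k, x k * ∑ l, Dk l v x * Dk k (Dk l v) x) * ψ (‖x‖ ^ 2)
        + (∑ k, x k * Dk k v x) * (∑ j, Dk j (Dk j v) x) * ψ (‖x‖ ^ 2)
        + 2 * ψ' (‖x‖ ^ 2) * (∑ k, x k * Dk k v x) ^ 2) = 0 := by
  have hD : ∀ k, ContDiffOn ℝ (⊤ : ℕ∞) (Dk k v) (ball 0 R) := fun k => smooth_Dk isOpen_ball hv
  have hG : ContDiffOn ℝ (⊤ : ℕ∞) (fun y : E3 => ∑ k, y k * Dk k v y) (ball 0 R) :=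
    ContDiffOn.sum fun k _ => (contDiff_coord k).contDiffOn.mul (hD k)
  refine div_zero_int R r hr
    (fun j y => (∑ k, y k * Dk k v y) * (Dk j v y * ψ (‖y‖ ^ 2))) ?_ ?_ _ ?_
  · intro j
    exact (hG.of_le le_top1).mul
      (((hD j).of_le le_top1).mul (contDiff_rad h hc).contDiffOn)
  · intro j x hx
    simp only
    rw [hz _ (by gcongr)]
    simp
  · intro x hx
    have h1 : ∀ j : Fin 3, DifferentiableAt ℝ (fun y : E3 => y j) x := fun j =>
      (contDiff_coord j).differentiable (by simp) x
    have h2 := fun j => diffAt_of isOpen_ball (hD j) hx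
    have h3 : DifferentiableAt ℝ (fun y : E3 => ψ (‖y‖ ^ 2)) x :=
      (hasFDerivAt_rad (h _)).differentiableAt
    have h4 := diffAt_of isOpen_ball hG hx
    have e1 : ∀ j, Dk j (fun y : E3 => ∑ k, y k * Dk k v y) x =
        Dk j v x + ∑ k, x k * Dk j (Dk k v) x := by
      intro j
      rw [Dk_sum _ (fun k _ => (h1 k).fun_mul (h2 k))]
      have : ∀ k : Fin 3, Dk j (fun y : E3 => y k * Dk k v y) x =
          (if k = j then 1 else 0) * Dk k v x + x k * Dk j (Dk k v) x := by
        intro k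
        rw [Dk_mul (h1 k) (h2 k), Dk_coord]
      simp [this, Finset.sum_add_distrib]
    have e : ∀ j, Dk j (fun y => (∑ k, y k * Dk k v y) * (Dk j v y * ψ (‖y‖ ^ 2))) x =
        (Dk j v x + ∑ k, x k * Dk j (Dk k v) x) * (Dk j v x * ψ (‖x‖ ^ 2)) +
        (∑ k, x k * Dk k v x) * (Dk j (Dk j v) x * ψ (‖x‖ ^ 2) +
          Dk j v x * (ψ' (‖x‖ ^ 2) * (2 * x j))) := by
      intro j
      rw [Dk_mul h4 ((h2 j).fun_mul h3), Dk_mul (h2 j) h3, e1, Dk_rad (h _)]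
    simp only [e]
    simp only [Fin.sum_univ_three]
    rw [Dk_comm (k := 1) (l := 0) isOpen_ball hv hx, Dk_comm (k := 2) (l := 0) isOpen_ball hv hx,
      Dk_comm (k := 2) (l := 1) isOpen_ball hv hx]
    ring

lemma energy_id {R r : ℝ} (hr0 : 0 ≤ r) (hr : r < R) {ψ ψ' ψ'' : ℝ → ℝ}
    (h : ∀ s, HasDerivAt ψ (ψ' s) s) (h' : ∀ s, HasDerivAt ψ' (ψ'' s) s)
    (hc : Continuous ψ'') (hz : ∀ s, r ^ 2 ≤ s → ψ s = 0) (hz' : ∀ s, r ^ 2 ≤ s → ψ' s = 0)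
    {v : E3 → ℝ} (hv : ContDiffOn ℝ (⊤ : ℕ∞) v (ball 0 R)) :
    IntegrableOn (fun x => (∑ j, Dk j v x ^ 2) * ψ (‖x‖ ^ 2)
        + v x * (∑ j, Dk j (Dk j v) x) * ψ (‖x‖ ^ 2)
        - v x ^ 2 * (3 * ψ' (‖x‖ ^ 2) + 2 * ‖x‖ ^ 2 * ψ'' (‖x‖ ^ 2))) (ball 0 R) ∧
      ∫ x in ball (0 : E3) R, ((∑ j, Dk j v x ^ 2) * ψ (‖x‖ ^ 2)
        + v x * (∑ j, Dk j (Dk j v) x) * ψ (‖x‖ ^ 2)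
        - v x ^ 2 * (3 * ψ' (‖x‖ ^ 2) + 2 * ‖x‖ ^ 2 * ψ'' (‖x‖ ^ 2))) = 0 := by
  have hD : ∀ k, ContDiffOn ℝ (⊤ : ℕ∞) (Dk k v) (ball 0 R) := fun k => smooth_Dk isOpen_ball hv
  have hc1 : Continuous ψ' := continuous_iff_continuousAt.2 fun s => (h' s).continuousAt
  refine div_zero_int R r hr
    (fun j y => (v y * (Dk j v y * ψ (‖y‖ ^ 2))) - (v y * v y) * (y j * ψ' (‖y‖ ^ 2))) ?_ ?_ _ ?_
  · intro j
    exact ((hv.of_le le_top1).mul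
      (((hD j).of_le le_top1).mul (contDiff_rad h hc1).contDiffOn)).sub
      (((hv.of_le le_top1).mul (hv.of_le le_top1)).mul
        (((contDiff_coord j).of_le le_top1).contDiffOn.mul (contDiff_rad h' hc).contDiffOn))
  · intro j x hx
    simp only
    rw [hz _ (by gcongr), hz' _ (by gcongr)]
    simp
  · intro x hx
    have h1 : ∀ j : Fin 3, DifferentiableAt ℝ (fun y : E3 => y j) x := fun j =>
      (contDiff_coord j).differentiable (by simp) x
    have h2 := fun j => diffAt_of isOpen_ball (hD j) hx
    have h3 : DifferentiableAt ℝ (fun y : E3 => ψ (‖y‖ ^ 2)) x :=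
      (hasFDerivAt_rad (h _)).differentiableAt
    have h3' : DifferentiableAt ℝ (fun y : E3 => ψ' (‖y‖ ^ 2)) x :=
      (hasFDerivAt_rad (h' _)).differentiableAt
    have h4 := diffAt_of isOpen_ball hv hx
    have e : ∀ j, Dk j (fun y => (v y * (Dk j v y * ψ (‖y‖ ^ 2)))
          - (v y * v y) * (y j * ψ' (‖y‖ ^ 2))) x =
        Dk j v x * (Dk j v x * ψ (‖x‖ ^ 2)) + v x * (Dk j (Dk j v) x * ψ (‖x‖ ^ 2) +
          Dk j v x * (ψ' (‖x‖ ^ 2) * (2 * x j))) -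
        ((Dk j v x * v x + v x * Dk j v x) * (x j * ψ' (‖x‖ ^ 2)) +
          (v x * v x) * (ψ' (‖x‖ ^ 2) + x j * (ψ'' (‖x‖ ^ 2) * (2 * x j)))) := by
      intro j
      rw [Dk_sub (h4.fun_mul ((h2 j).fun_mul h3)) ((h4.fun_mul h4).fun_mul ((h1 j).fun_mul h3')),
        Dk_mul h4 ((h2 j).fun_mul h3), Dk_mul (h2 j) h3, Dk_mul (h4.fun_mul h4) ((h1 j).fun_mul h3'),
        Dk_mul h4 h4, Dk_mul (h1 j) h3', Dk_rad (h _), Dk_rad (h' _), Dk_coord]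
      simp
    simp only [e]
    simp only [Fin.sum_univ_three]
    linear_combination (2 * ψ'' (‖x‖ ^ 2) * v x ^ 2) * (sum_sq_eq x)


lemma fbulk_eq (a b c : ℝ) (A : M3) : fbulk a b c A = kconst a b c
    - a / 2 * (∑ i, ∑ j, A i j * A j i) - b / 3 * (∑ i, ∑ j, (∑ l, A i l * A l j) * A j i)
    + c / 4 * ((∑ i, ∑ j, A i j * A j i) * (∑ i, ∑ j, A i j * A j i)) := by
  simp only [fbulk, Matrix.trace, Matrix.diag, Matrix.mul_apply]
  ring

lemma normSqM_eq (A : M3) : normSqM A = ∑ i, ∑ j, A i j * A j i := by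
  simp only [normSqM, Matrix.trace, Matrix.diag, Matrix.mul_apply]

lemma normSqM_frob {A : M3} (hA : A ∈ S0) : normSqM A = frobSq A := by
  rw [normSqM_eq, frobSq]
  refine Finset.sum_congr rfl fun i _ => Finset.sum_congr rfl fun j _ => ?_
  rw [hA.1.apply i j]
  ring

lemma frobSq_nonneg (A : M3) : 0 ≤ frobSq A :=
  Finset.sum_nonneg fun _ _ => Finset.sum_nonneg fun _ _ => sq_nonneg _

lemma gradSq_nonneg (Q : E3 → M3) (x : E3) : 0 ≤ gradSq Q x :=
  Finset.sum_nonneg fun _ _ => frobSq_nonneg _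

lemma EL_comp {a b c ε : ℝ} {Q : E3 → M3} {x : E3} (h : ELeq a b c ε Q x) (i j : Fin 3) :
    ε ^ 2 * ∑ k, Dk k (Dk k (fun y => Q y i j)) x = -a * Q x i j - b * (∑ l, Q x i l * Q x l j)
      + b / 3 * normSqM (Q x) * (if i = j then 1 else 0) + c * normSqM (Q x) * Q x i j := by
  have h1 := congrFun (congrFun h i) j
  have h2 : lapM Q x i j = ∑ k, Dk k (Dk k (fun y => Q y i j)) x := by
    simp only [lapM, Matrix.sum_apply]
    rfl
  simp only [Matrix.add_apply, Matrix.sub_apply, Matrix.smul_apply, h2, smul_eq_mul,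
    Matrix.mul_apply, Matrix.one_apply, Matrix.zero_apply] at h1
  linarith

lemma alg_grad (a b c : ℝ) (A P : Fin 3 → Fin 3 → ℝ) (hA : ∀ i j, A i j = A j i)
    (hP : ∑ i, P i i = 0) :
    - a / 2 * (∑ i, ∑ j, (P i j * A j i + A i j * P j i))
    - b / 3 * (∑ i, ∑ j, ((∑ l, (P i l * A l j + A i l * P l j)) * A j i
      + (∑ l, A i l * A l j) * P j i))
    + c / 4 * (2 * (∑ i, ∑ j, A i j * A j i) * (∑ i, ∑ j, (P i j * A j i + A i j * P j i)))
    = ∑ i, ∑ j, (-a * A i j - b * (∑ l, A i l * A l j)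
      + b / 3 * (∑ i, ∑ j, A i j * A j i) * (if i = j then 1 else 0)
      + c * (∑ i, ∑ j, A i j * A j i) * A i j) * P i j := by
  simp only [Fin.sum_univ_three] at hP ⊢
  rw [hA 1 0, hA 2 0, hA 2 1]
  simp
  have h2 : P 2 2 = - P 0 0 - P 1 1 := by linarith
  rw [h2]
  ring

lemma Dk_fbulk {a b c ε : ℝ} {Q : E3 → M3} {U : Set E3} (hU : IsOpen U)
    (hQ : ∀ i j, ContDiffOn ℝ (⊤ : ℕ∞) (fun y => Q y i j) U) (hS : ∀ x ∈ U, Q x ∈ S0)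
    (hEL : ∀ x ∈ U, ELeq a b c ε Q x) {x : E3} (hx : x ∈ U) (k : Fin 3) :
    Dk k (fun y => fbulk a b c (Q y)) x =
      ∑ i, ∑ j, (ε ^ 2 * ∑ k, Dk k (Dk k (fun y => Q y i j)) x) * Dk k (fun y => Q y i j) x := by
  have hd : ∀ i j, DifferentiableAt ℝ (fun y => Q y i j) x := fun i j => diffAt_of hU (hQ i j) hx
  have hP : ∑ i, Dk k (fun y => Q y i i) x = 0 := by
    rw [← Dk_sum _ (fun i _ => hd i i)]
    rw [Dk_congr (g := fun _ => 0) hU hx, Dk_const]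
    intro y hy
    exact (hS y hy).2
  have hA : ∀ i j, Q x i j = Q x j i := fun i j => ((hS x hx).1.apply i j).symm
  have key := alg_grad a b c (fun i j => Q x i j) (fun i j => Dk k (fun y => Q y i j) x) hA hP
  simp only [EL_comp (hEL x hx), normSqM_eq]
  rw [← key]
  have d2 : DifferentiableAt ℝ (fun y => ∑ i, ∑ j, Q y i j * Q y j i) x :=
    DifferentiableAt.fun_sum fun i _ => DifferentiableAt.fun_sum fun j _ => (hd i j).fun_mul (hd j i)
  have d3a : ∀ i j, DifferentiableAt ℝ (fun y => ∑ l, Q y i l * Q y l j) x := fun i j =>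
    DifferentiableAt.fun_sum fun l _ => (hd i l).fun_mul (hd l j)
  have d3 : DifferentiableAt ℝ (fun y => ∑ i, ∑ j, (∑ l, Q y i l * Q y l j) * Q y j i) x :=
    DifferentiableAt.fun_sum fun i _ => DifferentiableAt.fun_sum fun j _ =>
      (d3a i j).fun_mul (hd j i)
  have e2 : Dk k (fun y => ∑ i, ∑ j, Q y i j * Q y j i) x = ∑ i, ∑ j,
      (Dk k (fun y => Q y i j) x * Q x j i + Q x i j * Dk k (fun y => Q y j i) x) := by
    rw [Dk_sum _ (fun i _ => DifferentiableAt.fun_sum fun j _ => (hd i j).fun_mul (hd j i))]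
    refine Finset.sum_congr rfl fun i _ => ?_
    rw [Dk_sum _ (fun j _ => (hd i j).fun_mul (hd j i))]
    exact Finset.sum_congr rfl fun j _ => Dk_mul (hd i j) (hd j i)
  have e3a : ∀ i j, Dk k (fun y => ∑ l, Q y i l * Q y l j) x = ∑ l,
      (Dk k (fun y => Q y i l) x * Q x l j + Q x i l * Dk k (fun y => Q y l j) x) := by
    intro i j
    rw [Dk_sum _ (fun l _ => (hd i l).fun_mul (hd l j))]
    exact Finset.sum_congr rfl fun l _ => Dk_mul (hd i l) (hd l j)
  have e3 : Dk k (fun y => ∑ i, ∑ j, (∑ l, Q y i l * Q y l j) * Q y j i) x = ∑ i, ∑ j,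
      ((∑ l, (Dk k (fun y => Q y i l) x * Q x l j + Q x i l * Dk k (fun y => Q y l j) x))
        * Q x j i + (∑ l, Q x i l * Q x l j) * Dk k (fun y => Q y j i) x) := by
    rw [Dk_sum _ (fun i _ => DifferentiableAt.fun_sum fun j _ => (d3a i j).fun_mul (hd j i))]
    refine Finset.sum_congr rfl fun i _ => ?_
    rw [Dk_sum _ (fun j _ => (d3a i j).fun_mul (hd j i))]
    refine Finset.sum_congr rfl fun j _ => ?_
    rw [Dk_mul (d3a i j) (hd j i), e3a]
  simp only [fbulk_eq]
  have dc : ∀ r : ℝ, DifferentiableAt ℝ (fun _ : E3 => r) x := fun r => differentiableAt_const r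
  rw [Dk_add (((dc _).fun_sub ((dc _).fun_mul d2)).fun_sub ((dc _).fun_mul d3))
      ((dc _).fun_mul (d2.fun_mul d2)),
    Dk_sub ((dc _).fun_sub ((dc _).fun_mul d2)) ((dc _).fun_mul d3),
    Dk_sub (dc _) ((dc _).fun_mul d2), Dk_mul (dc _) d2, Dk_mul (dc _) d3,
    Dk_mul (dc _) (d2.fun_mul d2), Dk_mul d2 d2, e2, e3]
  simp only [Dk_const]
  ring

lemma smooth_fbulk {a b c : ℝ} {Q : E3 → M3} {U : Set E3}
    (hQ : ∀ i j, ContDiffOn ℝ (⊤ : ℕ∞) (fun y => Q y i j) U) :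
    ContDiffOn ℝ (⊤ : ℕ∞) (fun y => fbulk a b c (Q y)) U := by
  simp only [fbulk_eq]
  have d2 : ContDiffOn ℝ (⊤ : ℕ∞) (fun y => ∑ i, ∑ j, Q y i j * Q y j i) U :=
    ContDiffOn.sum fun i _ => ContDiffOn.sum fun j _ => (hQ i j).mul (hQ j i)
  have d3 : ContDiffOn ℝ (⊤ : ℕ∞) (fun y => ∑ i, ∑ j, (∑ l, Q y i l * Q y l j) * Q y j i) U :=
    ContDiffOn.sum fun i _ => ContDiffOn.sum fun j _ =>
      (ContDiffOn.sum fun l _ => (hQ i l).mul (hQ l j)).mul (hQ j i)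
  exact ((contDiffOn_const.sub (contDiffOn_const.mul d2)).sub (contDiffOn_const.mul d3)).add
    (contDiffOn_const.mul (d2.mul d2))

lemma gradSq_eq (Q : E3 → M3) (x : E3) :
    gradSq Q x = ∑ k, ∑ i, ∑ j, Dk k (fun y => Q y i j) x * Dk k (fun y => Q y i j) x := by
  simp only [gradSq, frobSq, sq]
  rfl

lemma dirD_eq (Q : E3 → M3) (x : E3) :
    frobSq (dirD Q x x) = ∑ i, ∑ j, (∑ k, x k * Dk k (fun y => Q y i j) x) ^ 2 := by
  simp only [frobSq, dirD, Matrix.sum_apply]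
  rfl

lemma smooth_gradSq {Q : E3 → M3} {U : Set E3} (hU : IsOpen U)
    (hQ : ∀ i j, ContDiffOn ℝ (⊤ : ℕ∞) (fun y => Q y i j) U) :
    ContDiffOn ℝ (⊤ : ℕ∞) (gradSq Q) U := by
  have : gradSq Q = fun x => ∑ k, ∑ i, ∑ j,
      Dk k (fun y => Q y i j) x * Dk k (fun y => Q y i j) x := funext (gradSq_eq Q)
  rw [this]
  exact ContDiffOn.sum fun k _ => ContDiffOn.sum fun i _ => ContDiffOn.sum fun j _ =>
    (smooth_Dk hU (hQ i j)).mul (smooth_Dk hU (hQ i j))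

lemma smooth_eDen {a b c ε : ℝ} {Q : E3 → M3} {U : Set E3} (hU : IsOpen U)
    (hQ : ∀ i j, ContDiffOn ℝ (⊤ : ℕ∞) (fun y => Q y i j) U) :
    ContDiffOn ℝ (⊤ : ℕ∞) (eDen a b c ε Q) U :=
  (contDiffOn_const.mul (smooth_gradSq hU hQ)).add (contDiffOn_const.mul (smooth_fbulk hQ))

lemma Dk_eDen {a b c ε : ℝ} (hε : 0 < ε) {Q : E3 → M3} {U : Set E3} (hU : IsOpen U)
    (hQ : ∀ i j, ContDiffOn ℝ (⊤ : ℕ∞) (fun y => Q y i j) U) (hS : ∀ x ∈ U, Q x ∈ S0)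
    (hEL : ∀ x ∈ U, ELeq a b c ε Q x) {x : E3} (hx : x ∈ U) (k : Fin 3) :
    Dk k (eDen a b c ε Q) x = ∑ i, ∑ j,
      ((∑ l, Dk l (fun y => Q y i j) x * Dk k (Dk l (fun y => Q y i j)) x)
        + (∑ l, Dk l (Dk l (fun y => Q y i j)) x) * Dk k (fun y => Q y i j) x) := by
  have dc : ∀ r : ℝ, DifferentiableAt ℝ (fun _ : E3 => r) x := fun r => differentiableAt_const r
  have hg := diffAt_of hU (smooth_gradSq hU hQ) hx
  have hf := diffAt_of hU (smooth_fbulk (a := a) (b := b) (c := c) hQ) hx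
  have hd : ∀ l i j, DifferentiableAt ℝ (Dk l (fun y => Q y i j)) x := fun l i j =>
    diffAt_of hU (smooth_Dk hU (hQ i j)) hx
  have e1 : Dk k (gradSq Q) x = ∑ i, ∑ j,
      (2 * ∑ l, Dk l (fun y => Q y i j) x * Dk k (Dk l (fun y => Q y i j)) x) := by
    have : gradSq Q = fun x => ∑ i, ∑ j, ∑ k,
        Dk k (fun y => Q y i j) x * Dk k (fun y => Q y i j) x := by
      funext z
      rw [gradSq_eq, Finset.sum_comm]
      refine Finset.sum_congr rfl fun i _ => ?_
      rw [Finset.sum_comm]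
    rw [this]
    rw [Dk_sum _ (fun i _ => DifferentiableAt.fun_sum fun j _ => DifferentiableAt.fun_sum fun l _ =>
      (hd l i j).fun_mul (hd l i j))]
    refine Finset.sum_congr rfl fun i _ => ?_
    rw [Dk_sum _ (fun j _ => DifferentiableAt.fun_sum fun l _ =>
      (hd l i j).fun_mul (hd l i j))]
    refine Finset.sum_congr rfl fun j _ => ?_
    rw [Dk_sum _ (fun l _ => (hd l i j).fun_mul (hd l i j)), Finset.mul_sum]
    refine Finset.sum_congr rfl fun l _ => ?_
    rw [Dk_mul (hd l i j) (hd l i j)]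
    ring
  have e0 : eDen a b c ε Q = fun y => 1 / 2 * gradSq Q y + 1 / ε ^ 2 * fbulk a b c (Q y) := rfl
  rw [e0, Dk_add ((dc _).fun_mul hg) ((dc _).fun_mul hf), Dk_mul (dc _) hg, Dk_mul (dc _) hf, e1,
    Dk_fbulk hU hQ hS hEL hx, Dk_const, Dk_const, zero_mul, zero_mul, zero_add, zero_add,
    Finset.mul_sum, Finset.mul_sum, ← Finset.sum_add_distrib]
  refine Finset.sum_congr rfl fun i _ => ?_
  rw [Finset.mul_sum, Finset.mul_sum, ← Finset.sum_add_distrib]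
  refine Finset.sum_congr rfl fun j _ => ?_
  field_simp

lemma poho_cut {a b c ε : ℝ} (hε : 0 < ε) {Q : E3 → M3} {R r : ℝ}
    (hQ : ∀ i j, ContDiffOn ℝ (⊤ : ℕ∞) (fun y => Q y i j) (ball 0 R))
    (hS : ∀ x ∈ ball (0 : E3) R, Q x ∈ S0)
    (hEL : ∀ x ∈ ball (0 : E3) R, ELeq a b c ε Q x)
    (hr0 : 0 ≤ r) (hr : r < R) {ψ ψ' : ℝ → ℝ}
    (h : ∀ s, HasDerivAt ψ (ψ' s) s) (hc : Continuous ψ') (hz : ∀ s, r ^ 2 ≤ s → ψ s = 0) :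
    ∫ x in ball (0 : E3) R, (eDen a b c ε Q x * ψ (‖x‖ ^ 2)
      + 2 / ε ^ 2 * fbulk a b c (Q x) * ψ (‖x‖ ^ 2)
      + 2 * ‖x‖ ^ 2 * ψ' (‖x‖ ^ 2) * eDen a b c ε Q x
      - 2 * ψ' (‖x‖ ^ 2) * frobSq (dirD Q x x)) = 0 := by
  have hp := poho_pot hr0 hr h hc hz (smooth_eDen (a := a) (b := b) (c := c) (ε := ε)
    isOpen_ball hQ)
  have hs := fun i j => poho_str hr0 hr h hc hz (hQ i j)
  have hsi := integrable_finsetSum (μ := volume.restrict (ball (0 : E3) R)) Finset.univ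
    (fun i _ => integrable_finsetSum Finset.univ (fun j _ => (hs i j).1))
  have hs0 := integral_finsetSum (μ := volume.restrict (ball (0 : E3) R)) Finset.univ
    (fun i _ => integrable_finsetSum Finset.univ (fun j _ => (hs i j).1))
  have hs1 := fun i : Fin 3 => integral_finsetSum (μ := volume.restrict (ball (0 : E3) R))
    Finset.univ (fun j _ => (hs i j).1)
  simp only [hs1, (hs _ _).2, Finset.sum_const_zero] at hs0
  have ht := integral_sub hp.1 hsi
  rw [hs0, hp.2, sub_zero] at ht
  rw [← ht]
  refine setIntegral_congr_fun measurableSet_ball fun x hx => ?_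
  simp only [Dk_eDen hε isOpen_ball hQ hS hEL hx, dirD_eq]
  have he : eDen a b c ε Q x = 1 / 2 * gradSq Q x + 1 / ε ^ 2 * fbulk a b c (Q x) := rfl
  have hgr := gradSq_eq Q x
  have h3 : 3 * eDen a b c ε Q x - gradSq Q x
     = eDen a b c ε Q x + 2 / ε ^ 2 * fbulk a b c (Q x) := by
    rw [he]; ring
  have hg2 : gradSq Q x = ∑ i, ∑ j, ∑ k, Dk k (fun y => Q y i j) x ^ 2 := by
      rw [gradSq_eq, Finset.sum_comm]
      refine Finset.sum_congr rfl fun i _ => ?_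
      rw [Finset.sum_comm]
      simp only [sq]
  simp only [Finset.sum_add_distrib, ← Finset.sum_mul, ← Finset.mul_sum]
  rw [← hg2]
  have h5 : ∑ k, x k * (∑ i, ∑ j, ∑ l, Dk l (fun y => Q y i j) x * Dk k (Dk l (fun y => Q y i j)) x
      + ∑ i, ∑ j, (∑ l, Dk l (Dk l (fun y => Q y i j)) x) * Dk k (fun y => Q y i j) x)
    = (∑ i, ∑ j, ∑ k, x k * ∑ l, Dk l (fun y => Q y i j) x * Dk k (Dk l (fun y => Q y i j)) x)
     + ∑ i, ∑ j, (∑ k, x k * Dk k (fun y => Q y i j) x) *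
        (∑ l, Dk l (Dk l (fun y => Q y i j)) x) := by
    simp only [mul_add, Finset.sum_add_distrib]
    congr 1
    · simp only [Finset.mul_sum (a := x _)]
      rw [Finset.sum_comm]
      refine Finset.sum_congr rfl fun i _ => ?_
      rw [Finset.sum_comm]
    · simp only [Finset.mul_sum (a := x _)]
      rw [Finset.sum_comm]
      refine Finset.sum_congr rfl fun i _ => ?_
      rw [Finset.sum_comm]
      refine Finset.sum_congr rfl fun j _ => ?_
      rw [Finset.sum_mul]
      refine Finset.sum_congr rfl fun k _ => ?_
      ring
  rw [h5]
  linear_combination (-ψ (‖x‖ ^ 2)) * h3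


lemma hasDerivAt_maxpow (n : ℕ) (x : ℝ) :
    HasDerivAt (fun x : ℝ => (max x 0) ^ (n + 2)) ((n + 2 : ℝ) * (max x 0) ^ (n + 1)) x := by
  have hp : HasDerivAt (fun x : ℝ => x ^ (n + 2)) ((n + 2 : ℝ) * x ^ (n + 1)) x := by
    have := hasDerivAt_pow (n + 2) x
    simpa using this
  rcases lt_trichotomy x 0 with hx | hx | hx
  · rw [max_eq_right hx.le]
    have : HasDerivAt (fun _ : ℝ => (0 : ℝ)) 0 x := hasDerivAt_const x 0
    simp only [ne_eq, Nat.add_eq_zero_iff, one_ne_zero, and_false, not_false_eq_true, zero_pow,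
      mul_zero]
    refine this.congr_of_eventuallyEq ?_
    filter_upwards [Iio_mem_nhds hx] with y hy
    rw [max_eq_right (le_of_lt hy)]
    simp
  · subst hx
    simp only [max_self, ne_eq, Nat.add_eq_zero_iff, one_ne_zero, and_false, not_false_eq_true,
      zero_pow, mul_zero] at hp ⊢
    have h1 : HasDerivWithinAt (fun x : ℝ => (max x 0) ^ (n + 2)) 0 (Iic 0) 0 := by
      refine (hasDerivWithinAt_const (0 : ℝ) (Iic 0) (0 : ℝ)).congr ?_ ?_
      · intro y hy
        rw [max_eq_right hy]
        simp
      · simp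
    have h2 : HasDerivWithinAt (fun x : ℝ => (max x 0) ^ (n + 2)) 0 (Ici 0) 0 := by
      refine hp.hasDerivWithinAt.congr ?_ ?_
      · intro y hy
        rw [max_eq_left hy]
      · simp
    have := h1.union h2
    rwa [Iic_union_Ici, hasDerivWithinAt_univ] at this
  · rw [max_eq_left hx.le]
    refine hp.congr_of_eventuallyEq ?_
    filter_upwards [Ioi_mem_nhds hx] with y hy
    rw [max_eq_left (le_of_lt hy)]

lemma hasDerivAt_wp (T : ℝ) (n : ℕ) (s : ℝ) :
    HasDerivAt (fun s : ℝ => (max (T - s) 0) ^ (n + 2))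
      (-((n + 2 : ℝ) * (max (T - s) 0) ^ (n + 1))) s := by
  have h1 : HasDerivAt (fun s : ℝ => T - s) (-1) s := by
    simpa using (hasDerivAt_id s).const_sub T
  have := (hasDerivAt_maxpow n (T - s)).comp s h1
  simpa [Function.comp_def] using this

/-- cubic trace -/
def T3 (A : M3) : ℝ := ∑ i, ∑ j, (∑ l, A i l * A l j) * A j i

lemma abs_T3_le {A : M3} (hA : A ∈ S0) {t : ℝ} (ht : 0 < t) :
    |T3 A| ≤ 1 / 2 * (t * frobSq A + frobSq A ^ 2 / t) := by
  have hs : ∀ i j, A j i = A i j := fun i j => hA.1.apply i j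
  have hB : ∑ i, ∑ j, (∑ l, A i l * A l j) ^ 2 ≤ frobSq A ^ 2 := by
    have h1 : ∀ i j, (∑ l, A i l * A l j) ^ 2 ≤ (∑ l, A i l ^ 2) * (∑ l, A j l ^ 2) := by
      intro i j
      have := Finset.sum_mul_sq_le_sq_mul_sq Finset.univ (fun l => A i l) (fun l => A l j)
      simpa only [hs j] using this
    calc ∑ i, ∑ j, (∑ l, A i l * A l j) ^ 2
        ≤ ∑ i, ∑ j, (∑ l, A i l ^ 2) * (∑ l, A j l ^ 2) :=
          Finset.sum_le_sum fun i _ => Finset.sum_le_sum fun j _ => h1 i j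
      _ = frobSq A ^ 2 := by
          rw [frobSq, sq, Finset.sum_mul_sum]
  have h2 : |T3 A| ≤ ∑ i, ∑ j, 1 / 2 * (t * A i j ^ 2 + (∑ l, A i l * A l j) ^ 2 / t) := by
    refine (Finset.abs_sum_le_sum_abs _ _).trans (Finset.sum_le_sum fun i _ => ?_)
    refine (Finset.abs_sum_le_sum_abs _ _).trans (Finset.sum_le_sum fun j _ => ?_)
    rw [hs i j]
    generalize (∑ l, A i l * A l j) = p
    generalize A i j = q
    have e : 1 / 2 * (t * q ^ 2 + p ^ 2 / t) = (t ^ 2 * q ^ 2 + p ^ 2) / (2 * t) := by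
      field_simp
    rw [e, le_div_iff₀ (by positivity)]
    rcases abs_cases (p * q) with h | h <;> rw [h.1] <;>
      nlinarith [sq_nonneg (t * q - p), sq_nonneg (t * q + p)]
  refine h2.trans ?_
  simp only [← Finset.mul_sum, Finset.sum_add_distrib, ← Finset.sum_div]
  rw [← frobSq]
  gcongr

lemma coercive {a b c : ℝ} (ha : 0 ≤ a) (hb : 0 < b) (hc : 0 < c) {A : M3} (hA : A ∈ S0) :
    c / 2 * frobSq A ^ 2 - (a + b ^ 2 / c) ^ 2 / c
      ≤ -a * frobSq A - b * T3 A + c * frobSq A ^ 2 := by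
  have h := abs_T3_le hA (t := 2 * b / c) (by positivity)
  have h1 := le_trans (le_abs_self _) h
  have h2 : b * T3 A ≤ b ^ 2 / c * frobSq A + c / 4 * frobSq A ^ 2 := by
    have := mul_le_mul_of_nonneg_left h1 hb.le
    refine this.trans (le_of_eq ?_)
    field_simp
    ring
  set N := frobSq A
  set m := a + b ^ 2 / c with hm
  have h3 : 0 ≤ c / 4 * N ^ 2 - m * N + m ^ 2 / c := by
    have : c / 4 * N ^ 2 - m * N + m ^ 2 / c = (c / 2 * N - m) ^ 2 / c := by
      field_simp
      ring
    rw [this]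
    positivity
  have h4 : m * N = a * N + b ^ 2 / c * N := by rw [hm]; ring
  nlinarith

lemma fbulk_bound {a b c : ℝ} (ha : 0 ≤ a) (hb : 0 < b) (hc : 0 < c) :
    ∃ C, 0 ≤ C ∧ ∀ A ∈ S0, |fbulk a b c A| ≤ C * (1 + frobSq A ^ 2) := by
  refine ⟨|kconst a b c| + a + b + c, by positivity, fun A hA => ?_⟩
  have h := abs_T3_le hA (t := 1) one_pos
  have hN := frobSq_nonneg A
  rw [fbulk_eq, ← normSqM_eq, normSqM_frob hA]
  change |kconst a b c - a / 2 * frobSq A - b / 3 * T3 A + c / 4 * (frobSq A * frobSq A)| ≤ _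
  set N := frobSq A
  have e1 : |kconst a b c - a / 2 * N - b / 3 * T3 A + c / 4 * (N * N)| ≤
      |kconst a b c| + a / 2 * N + b / 3 * |T3 A| + c / 4 * (N * N) := by
    refine (abs_add_le _ _).trans ?_
    refine add_le_add ((abs_sub _ _).trans (add_le_add ((abs_sub _ _).trans (add_le_add le_rfl ?_)) ?_)) ?_
    · rw [abs_of_nonneg (by positivity)]
    · rw [abs_mul, abs_of_pos (by positivity)]
    · rw [abs_of_nonneg (by positivity)]
  refine e1.trans ?_
  have hk := abs_nonneg (kconst a b c)
  have hN1 : N ≤ 1 + N ^ 2 := by nlinarith [sq_nonneg (N - 1)]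
  have hT : |T3 A| ≤ 1 + N ^ 2 := by nlinarith
  have g1 : a / 2 * N ≤ a * (1 + N ^ 2) := by nlinarith
  have g2 : b / 3 * |T3 A| ≤ b * (1 + N ^ 2) := by nlinarith [abs_nonneg (T3 A)]
  have g3 : c / 4 * (N * N) ≤ c * (1 + N ^ 2) := by nlinarith [sq_nonneg N]
  have g4 : |kconst a b c| ≤ |kconst a b c| * (1 + N ^ 2) := by nlinarith [sq_nonneg N]
  nlinarith

lemma energy_bound {a b c ε : ℝ} (ha : 0 ≤ a) (hb : 0 < b) (hcc : 0 < c) (hε : 0 < ε)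
    {Q : E3 → M3} {R : ℝ}
    (hQ : ∀ i j, ContDiffOn ℝ (⊤ : ℕ∞) (fun y => Q y i j) (ball 0 R))
    (hS : ∀ x ∈ ball (0 : E3) R, Q x ∈ S0)
    (hEL : ∀ x ∈ ball (0 : E3) R, ELeq a b c ε Q x) :
    ∃ C, ∀ r, 0 ≤ r → r < R →
      IntegrableOn (fun x => (gradSq Q x + c / (4 * ε ^ 2) * frobSq (Q x) ^ 2)
        * (max (r ^ 2 - ‖x‖ ^ 2) 0) ^ 4) (ball 0 R) ∧
      ∫ x in ball (0 : E3) R, (gradSq Q x + c / (4 * ε ^ 2) * frobSq (Q x) ^ 2)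
        * (max (r ^ 2 - ‖x‖ ^ 2) 0) ^ 4 ≤ C := by
  set C1 := (a + b ^ 2 / c) ^ 2 / c with hC1
  have hC1p : 0 ≤ C1 := by positivity
  set C2 := C1 / ε ^ 2 * (R ^ 2) ^ 4 + (24 * R ^ 2) ^ 2 * ε ^ 2 / c with hC2
  refine ⟨∫ x in ball (0 : E3) R, C2, fun r hr0 hr => ?_⟩
  have hs := fun i j => energy_id hr0 hr (hasDerivAt_wp (r ^ 2) 2)
    (ψ'' := fun s => 12 * (max (r ^ 2 - s) 0) ^ 2)
    (by
      intro s
      have := (hasDerivAt_wp (r ^ 2) 1 s).const_mul (-4)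
      have e1 : (fun s : ℝ => -(((2 : ℕ) + 2 : ℝ) * (max (r ^ 2 - s) 0) ^ (2 + 1))) =
          fun s => -4 * (max (r ^ 2 - s) 0) ^ (1 + 2) := by
        funext s; push_cast; ring
      have e2 : 12 * (max (r ^ 2 - s) 0) ^ 2 =
          -4 * -(((1 : ℕ) + 2 : ℝ) * (max (r ^ 2 - s) 0) ^ (1 + 1)) := by
        push_cast; ring
      rw [e1, e2]
      exact this)
    (by fun_prop)
    (fun s hs => by rw [max_eq_right (by linarith)]; simp)
    (fun s hs => by rw [max_eq_right (by linarith)]; simp) (hQ i j)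
  have hsi := integrable_finsetSum (μ := volume.restrict (ball (0 : E3) R)) Finset.univ
    (fun i _ => integrable_finsetSum Finset.univ (fun j _ => (hs i j).1))
  have hs0 := integral_finsetSum (μ := volume.restrict (ball (0 : E3) R)) Finset.univ
    (fun i _ => integrable_finsetSum Finset.univ (fun j _ => (hs i j).1))
  have hs1 := fun i : Fin 3 => integral_finsetSum (μ := volume.restrict (ball (0 : E3) R))
    Finset.univ (fun j _ => (hs i j).1)
  simp only [hs1, (hs _ _).2, Finset.sum_const_zero] at hs0
  have hconst : IntegrableOn (fun _ : E3 => C2) (ball (0 : E3) R) :=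
    integrableOn_const (by exact measure_ball_lt_top.ne)
  have hJC := hsi.add hconst
  have hle : ∀ x ∈ ball (0 : E3) R, (gradSq Q x + c / (4 * ε ^ 2) * frobSq (Q x) ^ 2)
        * (max (r ^ 2 - ‖x‖ ^ 2) 0) ^ 4 ≤ (∑ i, ∑ j, ((∑ k, Dk k (fun y => Q y i j) x ^ 2)
        * (max (r ^ 2 - ‖x‖ ^ 2) 0) ^ (2 + 2)
        + Q x i j * (∑ k, Dk k (Dk k (fun y => Q y i j)) x) * (max (r ^ 2 - ‖x‖ ^ 2) 0) ^ (2 + 2)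
        - Q x i j ^ 2 * (3 * -(((2 : ℕ) + 2 : ℝ) * (max (r ^ 2 - ‖x‖ ^ 2) 0) ^ (2 + 1))
          + 2 * ‖x‖ ^ 2 * (12 * (max (r ^ 2 - ‖x‖ ^ 2) 0) ^ 2)))) + C2 := by
    intro x hx
    have hxR : ‖x‖ < R := by simpa using hx
    have hg2 : gradSq Q x = ∑ i, ∑ j, ∑ k, Dk k (fun y => Q y i j) x ^ 2 := by
      rw [gradSq_eq, Finset.sum_comm]
      refine Finset.sum_congr rfl fun i _ => ?_
      rw [Finset.sum_comm]
      simp only [sq]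
    have hu : ∑ i, ∑ j, Q x i j * (∑ k, Dk k (Dk k (fun y => Q y i j)) x) =
        (-a * frobSq (Q x) - b * T3 (Q x) + c * frobSq (Q x) ^ 2) / ε ^ 2 := by
      rw [eq_div_iff (by positivity), Finset.sum_mul]
      have h1 : ∀ i j, Q x i j * (∑ k, Dk k (Dk k (fun y => Q y i j)) x) * ε ^ 2 =
          Q x i j * (-a * Q x i j - b * (∑ l, Q x i l * Q x l j)
      + b / 3 * normSqM (Q x) * (if i = j then 1 else 0) + c * normSqM (Q x) * Q x i j) := by
        intro i j
        rw [← EL_comp (hEL x hx) i j]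
        ring
      simp only [Finset.sum_mul, h1]
      have htr : Q x 0 0 + Q x 1 1 + Q x 2 2 = 0 := by
        have := (hS x hx).2
        simpa [Matrix.trace, Fin.sum_univ_three] using this
      have hsy : ∀ i j, Q x j i = Q x i j := fun i j => (hS x hx).1.apply i j
      rw [normSqM_frob (hS x hx)]
      have h2 : ∀ i j, Q x i j * (-a * Q x i j - b * (∑ l, Q x i l * Q x l j)
        + b / 3 * frobSq (Q x) * (if i = j then 1 else 0) + c * frobSq (Q x) * Q x i j)
        = -a * Q x i j ^ 2 - b * ((∑ l, Q x i l * Q x l j) * Q x j i)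
          + b / 3 * frobSq (Q x) * (if i = j then Q x i j else 0)
          + c * frobSq (Q x) * Q x i j ^ 2 := by
        intro i j
        rw [hsy i j]
        split_ifs <;> ring
      simp only [h2, Finset.sum_add_distrib, Finset.sum_sub_distrib, ← Finset.mul_sum]
      rw [← frobSq, ← T3]
      simp only [Finset.sum_ite_eq, Finset.mem_univ, if_true, Fin.sum_univ_three, htr]
      ring
    have hco := coercive ha hb hcc (hS x hx)
    simp only [Finset.sum_add_distrib, Finset.sum_sub_distrib, ← Finset.sum_mul]
    rw [← hg2, ← frobSq, hu]
    have hN := frobSq_nonneg (Q x)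
    have hw0 : 0 ≤ max (r ^ 2 - ‖x‖ ^ 2) 0 := le_max_right _ _
    have hwR : max (r ^ 2 - ‖x‖ ^ 2) 0 ≤ R ^ 2 := by
      refine max_le ?_ (sq_nonneg _)
      nlinarith [sq_nonneg ‖x‖]
    have hx2 : ‖x‖ ^ 2 ≤ R ^ 2 := by
      have := norm_nonneg x
      gcongr
    have hx0 := sq_nonneg ‖x‖
    generalize ‖x‖ ^ 2 = s at *
    generalize max (r ^ 2 - s) 0 = w at *
    generalize frobSq (Q x) = N at *
    generalize gradSq Q x = g at *
    generalize T3 (Q x) = t at *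
    have k1 : c / (2 * ε ^ 2) * N ^ 2 * w ^ 4 - C1 / ε ^ 2 * (R ^ 2) ^ 4 ≤
        (-a * N - b * t + c * N ^ 2) / ε ^ 2 * w ^ 4 := by
      have q1 : (c / 2 * N ^ 2 - C1) / ε ^ 2 * w ^ 4 ≤
          (-a * N - b * t + c * N ^ 2) / ε ^ 2 * w ^ 4 := by gcongr
      have q2 : C1 / ε ^ 2 * w ^ 4 ≤ C1 / ε ^ 2 * (R ^ 2) ^ 4 := by gcongr
      have q3 : (c / 2 * N ^ 2 - C1) / ε ^ 2 * w ^ 4 =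
        c / (2 * ε ^ 2) * N ^ 2 * w ^ 4 - C1 / ε ^ 2 * w ^ 4 := by
        field_simp
      linarith
    have k2 : N * (24 * R ^ 2 * w ^ 2) ≤ c / (4 * ε ^ 2) * N ^ 2 * w ^ 4
        + (24 * R ^ 2) ^ 2 * ε ^ 2 / c := by
      have : c / (4 * ε ^ 2) * N ^ 2 * w ^ 4
        + (24 * R ^ 2) ^ 2 * ε ^ 2 / c - N * (24 * R ^ 2 * w ^ 2) =
        (c * N * w ^ 2 / (2 * ε) - 24 * R ^ 2 * ε) ^ 2 / c := by
        field_simp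
        ring
      have : 0 ≤ (c * N * w ^ 2 / (2 * ε) - 24 * R ^ 2 * ε) ^ 2 / c := by positivity
      linarith
    have k3 : N * (2 * s * (12 * w ^ 2)) ≤ N * (24 * R ^ 2 * w ^ 2) := by
      have : s * w ^ 2 ≤ R ^ 2 * w ^ 2 := by gcongr
      apply mul_le_mul_of_nonneg_left _ hN
      linarith
    have k4 : 0 ≤ N * w ^ 3 := by positivity
    have k5 : c / (2 * ε ^ 2) * N ^ 2 * w ^ 4 = 2 * (c / (4 * ε ^ 2) * N ^ 2 * w ^ 4) := by
      field_simp
      ring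
    calc (g + c / (4 * ε ^ 2) * N ^ 2) * w ^ 4 = g * w ^ 4 + c / (4 * ε ^ 2) * N ^ 2 * w ^ 4 := by
          ring
      _ ≤ g * w ^ 4 + (-a * N - b * t + c * N ^ 2) / ε ^ 2 * w ^ 4 + 12 * (N * w ^ 3)
          - N * (2 * s * (12 * w ^ 2)) + C2 := by linarith
      _ = _ := by push_cast; ring
  have hmeas : AEStronglyMeasurable (fun x => (gradSq Q x + c / (4 * ε ^ 2) * frobSq (Q x) ^ 2)
        * (max (r ^ 2 - ‖x‖ ^ 2) 0) ^ 4) (volume.restrict (ball (0 : E3) R)) := by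
    refine ContinuousOn.aestronglyMeasurable ?_ measurableSet_ball
    have h1 : ContinuousOn (fun x => frobSq (Q x)) (ball 0 R) :=
      continuousOn_finsetSum _ fun i _ => continuousOn_finsetSum _ fun j _ =>
        (hQ i j).continuousOn.pow 2
    have h2 := (smooth_gradSq isOpen_ball hQ).continuousOn
    exact (h2.add (continuousOn_const.mul (h1.pow 2))).mul (by fun_prop)
  have hnn : ∀ x, 0 ≤ (gradSq Q x + c / (4 * ε ^ 2) * frobSq (Q x) ^ 2)
        * (max (r ^ 2 - ‖x‖ ^ 2) 0) ^ 4 := by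
    intro x
    have := gradSq_nonneg Q x
    positivity
  have hIntW : IntegrableOn (fun x => (gradSq Q x + c / (4 * ε ^ 2) * frobSq (Q x) ^ 2)
        * (max (r ^ 2 - ‖x‖ ^ 2) 0) ^ 4) (ball 0 R) := by
    refine hJC.mono' hmeas ?_
    refine (ae_restrict_iff' measurableSet_ball).2 (Filter.Eventually.of_forall fun x hx => ?_)
    rw [Real.norm_of_nonneg (hnn x)]
    exact hle x hx
  refine ⟨hIntW, ?_⟩
  have := setIntegral_mono_on hIntW hJC measurableSet_ball hle
  refine this.trans (le_of_eq ?_)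
  have e := integral_add hsi hconst
  rw [hs0, zero_add] at e
  exact e


lemma flat_bound (n : ℕ) : ∀ g : ℝ → ℝ, ContDiff ℝ (⊤ : ℕ∞) g → (∀ t, 10 ≤ t → g t = 0) →
    ∃ C, 0 ≤ C ∧ ∀ t, 0 ≤ t → |g t| ≤ C * (max (10 - t) 0) ^ n := by
  induction n with
  | zero =>
    intro g hg h0
    obtain ⟨C, hC⟩ := (isCompact_Icc (a := (0 : ℝ)) (b := 10)).exists_bound_of_continuousOn
      hg.continuous.continuousOn
    have hCp : 0 ≤ C := (norm_nonneg _).trans (hC 0 (by simp))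
    refine ⟨C, hCp, fun t ht => ?_⟩
    simp only [pow_zero, mul_one]
    by_cases h : t ≤ 10
    · exact hC t ⟨ht, h⟩
    · rw [h0 t (by linarith)]
      simpa using hCp
  | succ n ih =>
    intro g hg h0
    have hd : Differentiable ℝ g := hg.differentiable (by simp)
    have hdg : ContDiff ℝ (⊤ : ℕ∞) (deriv g) := by
      have := contDiff_infty_iff_deriv.1 hg
      exact this.2
    have h0' : ∀ t, 10 ≤ t → deriv g t = 0 := by
      intro t ht
      have h1 : HasDerivWithinAt g (deriv g t) (Ici t) t := (hd t).hasDerivAt.hasDerivWithinAt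
      have h2 : HasDerivWithinAt g 0 (Ici t) t := by
        refine (hasDerivWithinAt_const t (Ici t) (0 : ℝ)).congr ?_ (h0 t ht)
        intro y hy
        exact h0 y (ht.trans hy)
      exact (uniqueDiffWithinAt_Ici t).eq_deriv _ h1 h2
    obtain ⟨C, hC0, hC⟩ := ih (deriv g) hdg h0'
    refine ⟨C, hC0, fun t ht => ?_⟩
    by_cases h : t ≤ 10
    · have := Convex.norm_image_sub_le_of_norm_deriv_le (f := g) (s := Icc t 10)
        (C := C * (max (10 - t) 0) ^ n) (x := 10) (y := t) (fun x _ => hd x)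
        (fun x hx => by
          refine (hC x (ht.trans hx.1)).trans ?_
          gcongr
          exact hx.1) (convex_Icc _ _) ⟨h, le_rfl⟩ ⟨le_rfl, h⟩
      rw [h0 10 le_rfl, sub_zero] at this
      refine this.trans (le_of_eq ?_)
      rw [Real.norm_eq_abs, abs_of_nonpos (by linarith), max_eq_left (by linarith)]
      ring
    · rw [h0 t (by linarith)]
      simp only [abs_zero]
      positivity

lemma integrable_limit {a b c ε : ℝ} (ha : 0 ≤ a) (hb : 0 < b) (hcc : 0 < c) (hε : 0 < ε)
    {Q : E3 → M3} {R : ℝ} (hR : 0 < R)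
    (hQ : ∀ i j, ContDiffOn ℝ (⊤ : ℕ∞) (fun y => Q y i j) (ball 0 R))
    (hS : ∀ x ∈ ball (0 : E3) R, Q x ∈ S0)
    (hEL : ∀ x ∈ ball (0 : E3) R, ELeq a b c ε Q x) :
    IntegrableOn (fun x => (1 + (gradSq Q x + c / (4 * ε ^ 2) * frobSq (Q x) ^ 2))
        * (max (R ^ 2 - ‖x‖ ^ 2) 0) ^ 4) (ball 0 R) := by
  obtain ⟨C, hC⟩ := energy_bound ha hb hcc hε hQ hS hEL
  set r : ℕ → ℝ := fun n => R * (1 - 1 / ((n : ℝ) + 1)) with hrdef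
  have hr : ∀ n, 0 ≤ r n ∧ r n < R := by
    intro n
    have h1 : 0 < 1 / ((n : ℝ) + 1) := by positivity
    have h2 : 1 / ((n : ℝ) + 1) ≤ 1 := by
      rw [div_le_one (by positivity)]
      have : (0 : ℝ) ≤ n := by positivity
      linarith
    constructor
    · exact mul_nonneg hR.le (by linarith)
    · have : r n = R - R * (1 / ((n : ℝ) + 1)) := by simp only [hrdef]; ring
      rw [this]
      have := mul_pos hR h1
      linarith
  have hrlim : Filter.Tendsto r Filter.atTop (nhds R) := by
    have := (tendsto_one_div_add_atTop_nhds_zero_nat (𝕜 := ℝ)).const_sub 1 |>.const_mul R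
    have e : R * (1 - 0) = R := by ring
    rw [e] at this
    exact this
  set F : ℕ → E3 → ℝ := fun n x => (gradSq Q x + c / (4 * ε ^ 2) * frobSq (Q x) ^ 2)
        * (max (r n ^ 2 - ‖x‖ ^ 2) 0) ^ 4 with hF
  have hlim : ∀ x, Filter.Tendsto (fun n => F n x) Filter.atTop
      (nhds ((gradSq Q x + c / (4 * ε ^ 2) * frobSq (Q x) ^ 2)
        * (max (R ^ 2 - ‖x‖ ^ 2) 0) ^ 4)) := by
    intro x
    exact ((((hrlim.pow 2).sub_const _).max tendsto_const_nhds).pow 4).const_mul _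
  have hFi : ∀ n, Integrable (F n) (volume.restrict (ball (0 : E3) R)) := fun n =>
    (hC (r n) (hr n).1 (hr n).2).1
  have hFn : ∀ n x, 0 ≤ F n x := by
    intro n x
    have := gradSq_nonneg Q x
    simp only [hF]
    positivity
  have hmain : IntegrableOn (fun x => (gradSq Q x + c / (4 * ε ^ 2) * frobSq (Q x) ^ 2)
        * (max (R ^ 2 - ‖x‖ ^ 2) 0) ^ 4) (ball 0 R) := by
    refine ⟨aestronglyMeasurable_of_tendsto_ae Filter.atTop (fun n => (hFi n).1)
      (Filter.Eventually.of_forall hlim), ?_⟩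
    have h1 : ∫⁻ x in ball (0 : E3) R, ‖(gradSq Q x + c / (4 * ε ^ 2) * frobSq (Q x) ^ 2)
        * (max (R ^ 2 - ‖x‖ ^ 2) 0) ^ 4‖ₑ ≤
        Filter.liminf (fun n => ∫⁻ x in ball (0 : E3) R, ‖F n x‖ₑ) Filter.atTop := by
      have := lintegral_liminf_le' (μ := volume.restrict (ball (0 : E3) R)) (u := Filter.atTop)
        (f := fun n x => ‖F n x‖ₑ) (fun n => (hFi n).1.enorm)
      refine le_trans (le_of_eq ?_) this
      congr 1
      funext x
      exact ((hlim x).enorm.liminf_eq).symm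
    have h2 : ∀ n, ∫⁻ x in ball (0 : E3) R, ‖F n x‖ₑ ≤ ENNReal.ofReal C := by
      intro n
      rw [← ofReal_integral_norm_eq_lintegral_enorm (hFi n)]
      apply ENNReal.ofReal_le_ofReal
      have : ∀ x, ‖F n x‖ = F n x := fun x => Real.norm_of_nonneg (hFn n x)
      simp only [this]
      exact (hC (r n) (hr n).1 (hr n).2).2
    have h3 := Filter.liminf_le_liminf (f := Filter.atTop) (Filter.Eventually.of_forall h2)
    rw [Filter.liminf_const] at h3
    exact (h1.trans h3).trans_lt ENNReal.ofReal_lt_top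
  have hw : IntegrableOn (fun x : E3 => (max (R ^ 2 - ‖x‖ ^ 2) 0) ^ 4) (ball 0 R) := by
    have : Continuous (fun x : E3 => (max (R ^ 2 - ‖x‖ ^ 2) 0) ^ 4) := by fun_prop
    exact (this.continuousOn.integrableOn_compact (isCompact_closedBall (0 : E3) R)).mono_set
      ball_subset_closedBall
  refine (hw.add hmain).congr (Filter.Eventually.of_forall fun x => ?_)
  simp only [Pi.add_apply]
  ring

lemma dirD_le (Q : E3 → M3) (x : E3) : frobSq (dirD Q x x) ≤ ‖x‖ ^ 2 * gradSq Q x := by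
  have hg2 : gradSq Q x = ∑ i, ∑ j, ∑ k, Dk k (fun y => Q y i j) x ^ 2 := by
    rw [gradSq_eq, Finset.sum_comm]
    refine Finset.sum_congr rfl fun i _ => ?_
    rw [Finset.sum_comm]
    simp only [sq]
  rw [dirD_eq, hg2, Finset.mul_sum]
  refine Finset.sum_le_sum fun i _ => ?_
  rw [Finset.mul_sum]
  refine Finset.sum_le_sum fun j _ => ?_
  have := Finset.sum_mul_sq_le_sq_mul_sq Finset.univ (fun k => x k)
    (fun k => Dk k (fun y => Q y i j) x)
  rw [← sum_sq_eq, ← Fin.sum_univ_three (fun k => x k ^ 2)]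
  exact this

lemma abs_mul_le_bd {e p K g C w : ℝ} (he : |e| ≤ K * g) (hp : |p| ≤ C * w) (hK : 0 ≤ K * g) :
    |e * p| ≤ K * C * (g * w) := by
  rw [abs_mul]
  calc |e| * |p| ≤ (K * g) * (C * w) := mul_le_mul he hp (abs_nonneg _) hK
    _ = _ := by ring

theorem poho_main (a b c ε : ℝ) (ha : 0 ≤ a) (hb : 0 < b) (hc : 0 < c) (hε : 0 < ε)
    (φ : ℝ → ℝ) (hφs : ContDiff ℝ (⊤ : ℕ∞) φ) (hφ0 : ∀ t, 10 ≤ t → φ t = 0)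
    (Q : E3 → M3) (ρ : ℝ) (hρ : 0 < ρ) (R : ℝ) (hR : 0 < R) (hRρ : R ^ 2 = 10 * ρ ^ 2)
    (hQ : ∀ i j, ContDiffOn ℝ (⊤ : ℕ∞) (fun y => Q y i j) (ball 0 R))
    (hS : ∀ x ∈ ball (0 : E3) R, Q x ∈ S0)
    (hEL : ∀ x ∈ ball (0 : E3) R, ELeq a b c ε Q x) :
    (∫ y in ball (0 : E3) R,
        2 / ρ ^ 2 * deriv φ (‖y‖ ^ 2 / ρ ^ 2) * frobSq (dirD Q y y))
      = (∫ y in ball (0 : E3) R,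
          eDen a b c ε Q y * φ (‖y‖ ^ 2 / ρ ^ 2))
        + (∫ y in ball (0 : E3) R,
            2 / ε ^ 2 * fbulk a b c (Q y) * φ (‖y‖ ^ 2 / ρ ^ 2))
        + (∫ y in ball (0 : E3) R,
            2 * ‖y‖ ^ 2 / ρ ^ 2 * deriv φ (‖y‖ ^ 2 / ρ ^ 2) * eDen a b c ε Q y) := by
  have hdφ : ContDiff ℝ (⊤ : ℕ∞) (deriv φ) := (contDiff_infty_iff_deriv.1 hφs).2
  have hdiff : Differentiable ℝ φ := hφs.differentiable (by simp)
  have hdφ0 : ∀ t, 10 ≤ t → deriv φ t = 0 := by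
    intro t ht
    have h1 : HasDerivWithinAt φ (deriv φ t) (Ici t) t := (hdiff t).hasDerivAt.hasDerivWithinAt
    have h2 : HasDerivWithinAt φ 0 (Ici t) t := by
      refine (hasDerivWithinAt_const t (Ici t) (0 : ℝ)).congr ?_ (hφ0 t ht)
      intro y hy
      exact hφ0 y (ht.trans hy)
    exact (uniqueDiffWithinAt_Ici t).eq_deriv _ h1 h2
  obtain ⟨C0, hC0p, hC0⟩ := flat_bound 4 φ hφs hφ0
  obtain ⟨C1, hC1p, hC1⟩ := flat_bound 4 (deriv φ) hdφ hdφ0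
  obtain ⟨Cf, hCfp, hCf⟩ := fbulk_bound ha hb hc
  set κ := c / (4 * ε ^ 2) with hκ
  have hκp : 0 < κ := by positivity
  set g : E3 → ℝ := fun x => 1 + (gradSq Q x + κ * frobSq (Q x) ^ 2) with hg
  set W : E3 → ℝ := fun x => (max (R ^ 2 - ‖x‖ ^ 2) 0) ^ 4 with hW
  have hIntW : IntegrableOn (fun x => g x * W x) (ball 0 R) :=
    integrable_limit ha hb hc hε hR hQ hS hEL
  have hg0 : ∀ x, 1 ≤ g x := by
    intro x
    have := gradSq_nonneg Q x
    have : 0 ≤ κ * frobSq (Q x) ^ 2 := by positivity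
    simp only [hg]
    linarith
  have hW0 : ∀ x, 0 ≤ W x := fun x => by simp only [hW]; positivity
  -- shifted cutoff bounds
  have hwt : ∀ (x : E3) (δ : ℝ), 0 ≤ δ →
      (max (10 - (‖x‖ ^ 2 / ρ ^ 2 + δ)) 0) ^ 4 ≤ W x / ρ ^ 8 := by
    intro x δ hδ
    have h1 : max (10 - (‖x‖ ^ 2 / ρ ^ 2 + δ)) 0 ≤ max (R ^ 2 - ‖x‖ ^ 2) 0 / ρ ^ 2 := by
      refine max_le ?_ (by positivity)
      rw [le_div_iff₀ (by positivity)]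
      refine le_trans ?_ (le_max_left _ _)
      rw [hRρ]
      have : (10 - (‖x‖ ^ 2 / ρ ^ 2 + δ)) * ρ ^ 2 = 10 * ρ ^ 2 - ‖x‖ ^ 2 - δ * ρ ^ 2 := by
        field_simp
        ring
      rw [this]
      have : 0 ≤ δ * ρ ^ 2 := by positivity
      linarith
    calc _ ≤ (max (R ^ 2 - ‖x‖ ^ 2) 0 / ρ ^ 2) ^ 4 := by gcongr
      _ = W x / ρ ^ 8 := by simp only [hW]; rw [div_pow]; ring
  set C := (C0 + C1) / ρ ^ 8 with hC
  have hCp : 0 ≤ C := by positivity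
  have hb0 : ∀ (x : E3) (δ : ℝ), 0 ≤ δ → |φ (‖x‖ ^ 2 / ρ ^ 2 + δ)| ≤ C * W x := by
    intro x δ hδ
    refine (hC0 _ (by positivity)).trans ?_
    calc _ ≤ (C0 + C1) * (W x / ρ ^ 8) := by
          have := hwt x δ hδ
          gcongr
          linarith
      _ = _ := by rw [hC]; ring
  have hb1 : ∀ (x : E3) (δ : ℝ), 0 ≤ δ → |deriv φ (‖x‖ ^ 2 / ρ ^ 2 + δ)| ≤ C * W x := by
    intro x δ hδ
    refine (hC1 _ (by positivity)).trans ?_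
    calc _ ≤ (C0 + C1) * (W x / ρ ^ 8) := by
          have := hwt x δ hδ
          gcongr
          linarith
      _ = _ := by rw [hC]; ring
  -- bounds for the densities
  set K1 := Cf * (1 + 1 / κ) with hK1
  have hK1p : 0 ≤ K1 := by positivity
  have hfb : ∀ x ∈ ball (0 : E3) R, |fbulk a b c (Q x)| ≤ K1 * g x := by
    intro x hx
    refine (hCf _ (hS x hx)).trans ?_
    rw [hK1, mul_assoc]
    apply mul_le_mul_of_nonneg_left _ hCfp
    have h1 := gradSq_nonneg Q x
    have h2 : (1 + 1 / κ) * g x = 1 + gradSq Q x + κ * frobSq (Q x) ^ 2 + 1 / κ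
        + 1 / κ * gradSq Q x + frobSq (Q x) ^ 2 := by
      simp only [hg]
      field_simp
      ring
    rw [h2]
    have : 0 ≤ κ * frobSq (Q x) ^ 2 := by positivity
    have : 0 ≤ 1 / κ := by positivity
    have : 0 ≤ 1 / κ * gradSq Q x := by positivity
    linarith
  set K2 := 1 + 1 / ε ^ 2 * K1 with hK2
  have hK2p : 0 ≤ K2 := by positivity
  have heb : ∀ x ∈ ball (0 : E3) R, |eDen a b c ε Q x| ≤ K2 * g x := by
    intro x hx
    have h1 := gradSq_nonneg Q x
    have h3 : gradSq Q x ≤ g x := by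
      have : 0 ≤ κ * frobSq (Q x) ^ 2 := by positivity
      simp only [hg]; linarith
    unfold eDen
    refine (abs_add_le _ _).trans ?_
    rw [abs_mul (1 / ε ^ 2), abs_of_nonneg (a := 1 / 2 * gradSq Q x) (by positivity),
      abs_of_pos (a := 1 / ε ^ 2) (by positivity)]
    have h2 : 1 / ε ^ 2 * |fbulk a b c (Q x)| ≤ 1 / ε ^ 2 * (K1 * g x) :=
      mul_le_mul_of_nonneg_left (hfb x hx) (by positivity)
    rw [hK2]
    linarith
  have hdb : ∀ x ∈ ball (0 : E3) R, |frobSq (dirD Q x x)| ≤ R ^ 2 * g x := by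
    intro x hx
    have h1 := gradSq_nonneg Q x
    have h3 : gradSq Q x ≤ g x := by
      have : 0 ≤ κ * frobSq (Q x) ^ 2 := by positivity
      simp only [hg]; linarith
    have hxR : ‖x‖ < R := by simpa using hx
    rw [abs_of_nonneg (frobSq_nonneg _)]
    refine (dirD_le Q x).trans ?_
    gcongr
  -- continuity
  have cE : ContinuousOn (eDen a b c ε Q) (ball 0 R) := (smooth_eDen isOpen_ball hQ).continuousOn
  have cF : ContinuousOn (fun x => fbulk a b c (Q x)) (ball 0 R) := (smooth_fbulk hQ).continuousOn
  have cD : ContinuousOn (fun x => frobSq (dirD Q x x)) (ball 0 R) := by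
    simp only [dirD_eq]
    refine continuousOn_finsetSum _ fun i _ => continuousOn_finsetSum _ fun j _ =>
      ContinuousOn.pow (continuousOn_finsetSum _ fun k _ => ?_) 2
    exact (contDiff_coord k).continuous.continuousOn.mul
      (smooth_Dk isOpen_ball (hQ i j)).continuousOn
  have cφ : Continuous φ := hφs.continuous
  have cφ' : Continuous (deriv φ) := hdφ.continuous
  have cP : ∀ δ : ℝ, ContinuousOn (fun x : E3 => φ (‖x‖ ^ 2 / ρ ^ 2 + δ)) (ball 0 R) := fun δ =>
    Continuous.continuousOn (by fun_prop)
  have cP' : ∀ δ : ℝ, ContinuousOn (fun x : E3 => deriv φ (‖x‖ ^ 2 / ρ ^ 2 + δ)) (ball 0 R) :=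
    fun δ => Continuous.continuousOn (cφ'.comp (by fun_prop))
  have cN : ContinuousOn (fun x : E3 => 2 * ‖x‖ ^ 2 / ρ ^ 2) (ball 0 R) :=
    Continuous.continuousOn (by fun_prop)
  -- the four integrands with shift
  set A1 : ℝ → E3 → ℝ := fun δ x => eDen a b c ε Q x * φ (‖x‖ ^ 2 / ρ ^ 2 + δ) with hA1
  set A2 : ℝ → E3 → ℝ := fun δ x =>
    2 / ε ^ 2 * fbulk a b c (Q x) * φ (‖x‖ ^ 2 / ρ ^ 2 + δ) with hA2
  set A3 : ℝ → E3 → ℝ := fun δ x =>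
    2 * ‖x‖ ^ 2 / ρ ^ 2 * deriv φ (‖x‖ ^ 2 / ρ ^ 2 + δ) * eDen a b c ε Q x with hA3
  set A4 : ℝ → E3 → ℝ := fun δ x =>
    2 / ρ ^ 2 * deriv φ (‖x‖ ^ 2 / ρ ^ 2 + δ) * frobSq (dirD Q x x) with hA4
  have c1 : ∀ δ, ContinuousOn (A1 δ) (ball 0 R) := fun δ => cE.mul (cP δ)
  have c2 : ∀ δ, ContinuousOn (A2 δ) (ball 0 R) := fun δ =>
    (continuousOn_const.mul cF).mul (cP δ)
  have c3 : ∀ δ, ContinuousOn (A3 δ) (ball 0 R) := fun δ => (cN.mul (cP' δ)).mul cE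
  have c4 : ∀ δ, ContinuousOn (A4 δ) (ball 0 R) := fun δ =>
    (continuousOn_const.mul (cP' δ)).mul cD
  set L1 := K2 * C with hL1
  set L2 := 2 / ε ^ 2 * (K1 * C) with hL2
  set L3 := 20 * (K2 * C) with hL3
  set L4 := 2 / ρ ^ 2 * (R ^ 2 * C) with hL4
  have hgp : ∀ x, 0 ≤ g x := fun x => zero_le_one.trans (hg0 x)
  have b1 : ∀ δ, 0 ≤ δ → ∀ x ∈ ball (0 : E3) R, |A1 δ x| ≤ L1 * (g x * W x) := by
    intro δ hδ x hx
    exact abs_mul_le_bd (heb x hx) (hb0 x δ hδ) (mul_nonneg hK2p (hgp x))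
  have b2 : ∀ δ, 0 ≤ δ → ∀ x ∈ ball (0 : E3) R, |A2 δ x| ≤ L2 * (g x * W x) := by
    intro δ hδ x hx
    have := abs_mul_le_bd (hfb x hx) (hb0 x δ hδ) (mul_nonneg hK1p (hgp x))
    simp only [hA2]
    rw [mul_assoc, abs_mul, abs_of_pos (a := 2 / ε ^ 2) (by positivity), hL2, mul_assoc]
    gcongr
  have b3 : ∀ δ, 0 ≤ δ → ∀ x ∈ ball (0 : E3) R, |A3 δ x| ≤ L3 * (g x * W x) := by
    intro δ hδ x hx
    have := abs_mul_le_bd (heb x hx) (hb1 x δ hδ) (mul_nonneg hK2p (hgp x))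
    have hxR : ‖x‖ < R := by simpa using hx
    have h20 : 2 * ‖x‖ ^ 2 / ρ ^ 2 ≤ 20 := by
      rw [div_le_iff₀ (by positivity)]
      have : ‖x‖ ^ 2 ≤ R ^ 2 := by gcongr
      linarith
    simp only [hA3]
    rw [mul_assoc, abs_mul, mul_comm (deriv φ _),
      abs_of_nonneg (a := 2 * ‖x‖ ^ 2 / ρ ^ 2) (by positivity), hL3, mul_assoc]
    gcongr
  have b4 : ∀ δ, 0 ≤ δ → ∀ x ∈ ball (0 : E3) R, |A4 δ x| ≤ L4 * (g x * W x) := by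
    intro δ hδ x hx
    have := abs_mul_le_bd (hdb x hx) (hb1 x δ hδ) (mul_nonneg (sq_nonneg R) (hgp x))
    simp only [hA4]
    rw [mul_assoc, abs_mul, mul_comm (deriv φ _),
      abs_of_nonneg (a := 2 / ρ ^ 2) (by positivity), hL4, mul_assoc]
    gcongr
  have mkint : ∀ (f : E3 → ℝ) (L : ℝ), ContinuousOn f (ball 0 R) →
      (∀ x ∈ ball (0 : E3) R, |f x| ≤ L * (g x * W x)) → IntegrableOn f (ball 0 R) := by
    intro f L hf hL
    refine (hIntW.const_mul L).mono' (hf.aestronglyMeasurable measurableSet_ball) ?_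
    exact (ae_restrict_iff' measurableSet_ball).2 (Filter.Eventually.of_forall hL)
  have i1 := mkint _ _ (c1 0) (b1 0 le_rfl)
  have i2 := mkint _ _ (c2 0) (b2 0 le_rfl)
  have i3 := mkint _ _ (c3 0) (b3 0 le_rfl)
  have i4 := mkint _ _ (c4 0) (b4 0 le_rfl)
  -- identity for shifted cutoffs
  have hshift : ∀ n : ℕ, ∫ x in ball (0 : E3) R, (A1 (1 / ((n : ℝ) + 1)) x
      + A2 (1 / ((n : ℝ) + 1)) x + A3 (1 / ((n : ℝ) + 1)) x - A4 (1 / ((n : ℝ) + 1)) x) = 0 := by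
    intro n
    set δ := 1 / ((n : ℝ) + 1) with hδ
    have hδp : 0 < δ := by positivity
    have hδ1 : δ ≤ 1 := by
      rw [hδ, div_le_one (by positivity)]
      have : (0 : ℝ) ≤ n := by positivity
      linarith
    have hsq : (ρ * Real.sqrt (10 - δ)) ^ 2 = ρ ^ 2 * (10 - δ) := by
      rw [mul_pow, Real.sq_sqrt (by linarith)]
    have := poho_cut hε hQ hS hEL (r := ρ * Real.sqrt (10 - δ)) (by positivity)
      (by
        apply lt_of_pow_lt_pow_left₀ 2 hR.le
        rw [hsq, hRρ]
        have : 0 < δ * ρ ^ 2 := by positivity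
        linarith)
      (ψ := fun s => φ (s / ρ ^ 2 + δ)) (ψ' := fun s => deriv φ (s / ρ ^ 2 + δ) * (1 / ρ ^ 2))
      (by
        intro s
        have h1 : HasDerivAt (fun s : ℝ => s / ρ ^ 2 + δ) (1 / ρ ^ 2) s :=
          ((hasDerivAt_id s).div_const (ρ ^ 2)).add_const δ
        exact (hdiff (s / ρ ^ 2 + δ)).hasDerivAt.comp s h1)
      ((cφ'.comp (by fun_prop)).mul continuous_const)
      (by
        intro s hs
        apply hφ0
        rw [hsq] at hs
        have : 10 - δ ≤ s / ρ ^ 2 := by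
          rw [le_div_iff₀ (by positivity)]
          linarith
        linarith)
    rw [← this]
    refine setIntegral_congr_fun measurableSet_ball fun x _ => ?_
    simp only [hA1, hA2, hA3, hA4]
    ring
  have hlim : Filter.Tendsto (fun n : ℕ => ∫ x in ball (0 : E3) R, (A1 (1 / ((n : ℝ) + 1)) x
      + A2 (1 / ((n : ℝ) + 1)) x + A3 (1 / ((n : ℝ) + 1)) x - A4 (1 / ((n : ℝ) + 1)) x))
      Filter.atTop (nhds (∫ x in ball (0 : E3) R, (A1 0 x + A2 0 x + A3 0 x - A4 0 x))) := by
    refine tendsto_integral_of_dominated_convergence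
      (fun x => (L1 + L2 + L3 + L4) * (g x * W x)) ?_ (hIntW.const_mul _) ?_ ?_
    · intro n
      exact ((((c1 _).add (c2 _)).add (c3 _)).sub (c4 _)).aestronglyMeasurable measurableSet_ball
    · intro n
      refine (ae_restrict_iff' measurableSet_ball).2 (Filter.Eventually.of_forall fun x hx => ?_)
      have hδp : 0 ≤ 1 / ((n : ℝ) + 1) := by positivity
      have h1 := b1 _ hδp x hx
      have h2 := b2 _ hδp x hx
      have h3 := b3 _ hδp x hx
      have h4 := b4 _ hδp x hx
      rw [Real.norm_eq_abs]
      refine (abs_sub _ _).trans ?_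
      refine (add_le_add ((abs_add_le _ _).trans (add_le_add (abs_add_le _ _) le_rfl)) le_rfl).trans ?_
      linarith
    · refine Filter.Eventually.of_forall fun x => ?_
      have hδ := tendsto_one_div_add_atTop_nhds_zero_nat (𝕜 := ℝ)
      have t0 : Filter.Tendsto (fun n : ℕ => ‖x‖ ^ 2 / ρ ^ 2 + 1 / ((n : ℝ) + 1)) Filter.atTop
        (nhds (‖x‖ ^ 2 / ρ ^ 2 + 0)) := hδ.const_add _
      have t1 := (cφ.tendsto _).comp t0
      have t2 := (cφ'.tendsto _).comp t0
      exact (((t1.const_mul _).add (t1.const_mul _)).add ((t2.const_mul _).mul_const _)).sub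
        ((t2.const_mul _).mul_const _)
  simp only [hshift] at hlim
  have hfin := tendsto_nhds_unique hlim tendsto_const_nhds
  have e1 := integral_sub ((i1.add i2).add i3) i4
  have e2 := integral_add (i1.add i2) i3
  have e3 := integral_add i1 i2
  simp only [Pi.add_apply] at e1 e2 e3
  rw [e1, e2, e3] at hfin
  simp only [hA1, hA2, hA3, hA4, add_zero] at hfin
  linarith

/-- the Pohozaev-type identity. -/
theorem stmt2 (a b c ε : ℝ) (ha : 0 ≤ a) (hb : 0 < b) (hc : 0 < c) (hε : 0 < ε)
    (φ : ℝ → ℝ) (hφ : AdmissibleCutoff φ)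
    (ω : Set E3) (hω : IsOpen ω) (Q : E3 → M3)
    (hQsmooth : ContDiffOn ℝ (⊤ : ℕ∞) Q ω) (hQS0 : ∀ x ∈ ω, Q x ∈ S0)
    (hEL : ∀ x ∈ ω, ELeq a b c ε Q x)
    (ρ : ℝ) (hρ : 0 < ρ) (h0 : (0 : E3) ∈ ω)
    (hball : ball (0 : E3) (Real.sqrt 10 * ρ) ⊆ ω) :
    (∫ y in ball (0 : E3) (Real.sqrt 10 * ρ),
        2 / ρ ^ 2 * deriv φ (‖y‖ ^ 2 / ρ ^ 2) * frobSq (dirD Q y y))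
      = (∫ y in ball (0 : E3) (Real.sqrt 10 * ρ),
          eDen a b c ε Q y * φ (‖y‖ ^ 2 / ρ ^ 2))
        + (∫ y in ball (0 : E3) (Real.sqrt 10 * ρ),
            2 / ε ^ 2 * fbulk a b c (Q y) * φ (‖y‖ ^ 2 / ρ ^ 2))
        + (∫ y in ball (0 : E3) (Real.sqrt 10 * ρ),
            2 * ‖y‖ ^ 2 / ρ ^ 2 * deriv φ (‖y‖ ^ 2 / ρ ^ 2) * eDen a b c ε Q y) := by
  have hcomp : ∀ i j, ContDiffOn ℝ (⊤ : ℕ∞) (fun y => Q y i j) ω := by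
    intro i j
    have h1 := contDiffOn_pi.1 hQsmooth i
    exact contDiffOn_pi.1 h1 j
  refine poho_main a b c ε ha hb hc hε φ hφ.1 hφ.2.2.1 Q ρ hρ (Real.sqrt 10 * ρ) (by positivity) ?_
    (fun i j => (hcomp i j).mono hball) (fun x hx => hQS0 x (hball hx))
    (fun x hx => hEL x (hball hx))
  rw [mul_pow, Real.sq_sqrt (by norm_num)]

end
end

section
/- Let ω ⊂ ℝ³ be open, ε > 0, and let Q : ω → S₀ be a smooth solution of the Euler–Lagrange equation −ε²ΔQ − aQ − bQ² + (b/3)|Q|²I + c|Q|²Q = 0. Let φ be an admissible cutoff profile, x ∈ ω, and 0 < r < R < dist(x,∂ω)/10. Then Θ_R^φ(Q,x) − Θ_r^φ(Q,x) = ∫_r^R [ −(2/ρ²) ∫ |((y−x)/ρ)·∇Q(y)|² φ'(|y−x|²/ρ²) dy + (2/(ε²ρ²)) ∫ f(Q(y)) φ(|y−x|²/ρ²) dy ] dρ. In particular, since φ' ≤ 0 and f ≥ 0, the function ρ ↦ Θ_ρ^φ(Q,x) is nondecreasing on (0, dist(x,∂ω)/10). -/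
noncomputable section

open Matrix MeasureTheory Metric Set

attribute [local instance] Matrix.normedAddCommGroup Matrix.normedSpace

lemma aux_eig (Q : M3) (hQ : Q ∈ S0) : ∃ l m n : ℝ, l + m + n = 0 ∧
    (Q * Q).trace = l ^ 2 + m ^ 2 + n ^ 2 ∧ (Q * Q * Q).trace = l ^ 3 + m ^ 3 + n ^ 3 := by
  obtain ⟨hs, ht⟩ := hQ
  have hA : Q.IsHermitian := by
    rw [Matrix.IsHermitian, Matrix.conjTranspose_eq_transpose_of_trivial]; exact hs
  have h1 := hA.trace_eq_sum_eigenvalues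
  set φ := Unitary.conjStarAlgAut ℝ _ hA.eigenvectorUnitary with hφ
  set D : M3 := diagonal (RCLike.ofReal ∘ hA.eigenvalues) with hD
  have h2 : Q = φ D := hA.spectral_theorem
  have htr : ∀ X : M3, (φ X).trace = X.trace := by
    intro X
    rw [hφ, Unitary.conjStarAlgAut_apply, trace_mul_cycle, Unitary.coe_star_mul_self, one_mul]
  refine ⟨hA.eigenvalues 0, hA.eigenvalues 1, hA.eigenvalues 2, ?_, ?_, ?_⟩
  · rw [ht] at h1
    simpa [Fin.sum_univ_three] using h1.symm
  · have e : Q * Q = φ (D * D) := by rw [map_mul, ← h2]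
    rw [e, htr, hD, diagonal_mul_diagonal, trace_diagonal, Fin.sum_univ_three]
    simp [pow_two]
  · have e : Q * Q * Q = φ (D * D * D) := by rw [map_mul, map_mul, ← h2]
    rw [e, htr, hD, diagonal_mul_diagonal, diagonal_mul_diagonal,
      trace_diagonal, Fin.sum_univ_three]
    simp [pow_succ]

lemma fbulk_nonneg (a b c : ℝ) (ha : 0 ≤ a) (hb : 0 < b) (hc : 0 < c) (Q : M3) (hQ : Q ∈ S0) :
    0 ≤ fbulk a b c Q := by
  obtain ⟨l, m, n, h0, h2, h3⟩ := aux_eig Q hQ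
  have hn : n = -l - m := by linarith
  subst hn
  rw [fbulk, kconst]
  set u := sstar a b c with hu
  have hu0 : 0 < u := by rw [hu, sstar]; positivity
  have hu1 : 3 * a + b * u - 2 * c * u ^ 2 = 0 := by
    have hsq : Real.sqrt (b ^ 2 + 24 * a * c) ^ 2 = b ^ 2 + 24 * a * c :=
      Real.sq_sqrt (by positivity)
    rw [hu, sstar]
    generalize Real.sqrt (b ^ 2 + 24 * a * c) = w at hsq
    field_simp
    nlinarith
  set T := (Q * Q).trace with hT
  set C := (Q * Q * Q).trace with hC
  have hT0 : 0 ≤ T := by rw [h2]; positivity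
  set s := Real.sqrt (3 * T / 2) with hs
  have hs0 : 0 ≤ s := Real.sqrt_nonneg _
  have hs2 : s ^ 2 = 3 * T / 2 := Real.sq_sqrt (by positivity)
  have hTs : T = 2 / 3 * s ^ 2 := by linarith
  have hC1 : 6 * C ^ 2 ≤ T ^ 3 := by
    rw [h2, h3]
    have : 0 ≤ 2 * ((l - m) * (2 * l + m) * (l + 2 * m)) ^ 2 := by positivity
    nlinarith
  have hC2 : C ≤ 2 / 9 * s ^ 3 := by
    refine abs_le_of_sq_le_sq' ?_ (by positivity) |>.2
    rw [hTs] at hC1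
    nlinarith
  have ha' : a = (2 * c * u ^ 2 - b * u) / 3 := by linarith
  have hbc : b ≤ 2 * c * u := by
    by_contra hcon
    push Not at hcon
    nlinarith
  have key : 0 ≤ (s - u) ^ 2 * (3 * c * (s + u) ^ 2 - b * (2 * s + u)) := by
    apply mul_nonneg (sq_nonneg _)
    have : b * (2 * s + u) ≤ 2 * c * u * (2 * s + u) := by gcongr
    have h5 : 0 ≤ c * s ^ 2 := by positivity
    have h6 : 0 ≤ c * s * u := by positivity
    have h7 : 0 ≤ c * u ^ 2 := by positivity
    nlinarith
  have hbC : b * C ≤ b * (2 / 9 * s ^ 3) := by gcongr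
  rw [hTs, ha']
  nlinarith

/-- Partial derivative of a scalar function. -/
def Dp (k : Fin 3) (g : E3 → ℝ) (y : E3) : ℝ := fderiv ℝ g y (EuclideanSpace.single k 1)

abbrev Sm (g : E3 → ℝ) : Prop := ContDiff ℝ (⊤ : ℕ∞) g

lemma Sm.diff {g : E3 → ℝ} (hg : Sm g) (y : E3) : DifferentiableAt ℝ g y :=
  (hg.differentiable (by simp)).differentiableAt

lemma Sm.Dp {g : E3 → ℝ} (hg : Sm g) (k : Fin 3) : Sm (Dp k g) := by
  have : ContDiff ℝ (⊤ : ℕ∞) (fderiv ℝ g) := hg.fderiv_right (by simp)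
  exact this.clm_apply contDiff_const

lemma Dp_mul {f g : E3 → ℝ} (hf : Sm f) (hg : Sm g) (k : Fin 3) (y : E3) :
    Dp k (fun y => f y * g y) y = Dp k f y * g y + f y * Dp k g y := by
  unfold Dp
  rw [fderiv_fun_mul (hf.diff y) (hg.diff y)]
  simp; ring

lemma Dp_add {f g : E3 → ℝ} (hf : Sm f) (hg : Sm g) (k : Fin 3) (y : E3) :
    Dp k (fun y => f y + g y) y = Dp k f y + Dp k g y := by
  unfold Dp
  rw [fderiv_fun_add (hf.diff y) (hg.diff y)]
  simp

lemma Dp_sub {f g : E3 → ℝ} (hf : Sm f) (hg : Sm g) (k : Fin 3) (y : E3) :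
    Dp k (fun y => f y - g y) y = Dp k f y - Dp k g y := by
  unfold Dp
  rw [fderiv_fun_sub (hf.diff y) (hg.diff y)]
  simp

lemma Dp_sum {ι : Type*} (s : Finset ι) {f : ι → E3 → ℝ} (hf : ∀ i, Sm (f i)) (k : Fin 3) (y : E3) :
    Dp k (fun y => ∑ i ∈ s, f i y) y = ∑ i ∈ s, Dp k (f i) y := by
  unfold Dp
  rw [fderiv_fun_sum (fun i _ => (hf i).diff y)]
  simp

lemma Dp_const_mul (a : ℝ) {g : E3 → ℝ} (hg : Sm g) (k : Fin 3) (y : E3) :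
    Dp k (fun y => a * g y) y = a * Dp k g y := by
  unfold Dp
  rw [fderiv_const_mul (hg.diff y)]
  simp

lemma Dp_sq {g : E3 → ℝ} (hg : Sm g) (k : Fin 3) (y : E3) :
    Dp k (fun y => g y ^ 2) y = 2 * g y * Dp k g y := by
  simp only [pow_two]
  rw [Dp_mul hg hg]; ring

lemma Dp_comm {g : E3 → ℝ} (hg : Sm g) (k l : Fin 3) (y : E3) :
    Dp k (Dp l g) y = Dp l (Dp k g) y := by
  have h1 : ContDiff ℝ (⊤ : ℕ∞) (fderiv ℝ g) := hg.fderiv_right (by simp)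
  have h2 : DifferentiableAt ℝ (fderiv ℝ g) y := (h1.differentiable (by simp)).differentiableAt
  have h3 : IsSymmSndFDerivAt ℝ g y := hg.contDiffAt.isSymmSndFDerivAt (by
    simp only [minSmoothness_of_isRCLikeNormedField]
    exact WithTop.coe_le_coe.2 (le_top : (2 : ℕ∞) ≤ ⊤))
  have h4 : ∀ k l : Fin 3, Dp k (Dp l g) y =
      fderiv ℝ (fderiv ℝ g) y (EuclideanSpace.single k 1) (EuclideanSpace.single l 1) := by
    intro k l
    unfold Dp
    rw [fderiv_clm_apply h2 (differentiableAt_const _)]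
    simp
  rw [h4, h4]
  exact h3 _ _

lemma Sm_coord (x : E3) (l : Fin 3) : Sm (fun y : E3 => y l - x l) := by
  unfold Sm; fun_prop

lemma Dp_coord (x : E3) (k l : Fin 3) (y : E3) :
    Dp k (fun y : E3 => y l - x l) y = if k = l then 1 else 0 := by
  unfold Dp
  have : HasFDerivAt (fun y : E3 => y l - x l) (EuclideanSpace.proj l : E3 →L[ℝ] ℝ) y :=
    (EuclideanSpace.proj l : E3 →L[ℝ] ℝ).hasFDerivAt.sub_const _
  rw [this.fderiv]
  simp [eq_comm]

lemma normSq_coord (x y : E3) : ‖y - x‖ ^ 2 = ∑ l, (y l - x l) ^ 2 := by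
  rw [EuclideanSpace.norm_sq_eq]; simp

lemma Sm_cut {φ : ℝ → ℝ} (hφ : ContDiff ℝ (⊤ : ℕ∞) φ) (x : E3) (ρ : ℝ) :
    Sm (fun y => φ (‖y - x‖ ^ 2 / ρ ^ 2)) := by
  unfold Sm
  apply hφ.comp
  apply ContDiff.div_const
  exact (contDiff_id.sub contDiff_const).norm_sq ℝ

lemma Dp_cut {φ : ℝ → ℝ} (hφ : ContDiff ℝ (⊤ : ℕ∞) φ) (x : E3) (ρ : ℝ) (k : Fin 3) (y : E3) :
    Dp k (fun y => φ (‖y - x‖ ^ 2 / ρ ^ 2)) y =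
      deriv φ (‖y - x‖ ^ 2 / ρ ^ 2) * (2 * (y k - x k) / ρ ^ 2) := by
  have h1 : Sm (fun y : E3 => ‖y - x‖ ^ 2 / ρ ^ 2) := by
    apply ContDiff.div_const
    exact (contDiff_id.sub contDiff_const).norm_sq ℝ
  have h2 : Dp k (fun y : E3 => ‖y - x‖ ^ 2 / ρ ^ 2) y = 2 * (y k - x k) / ρ ^ 2 := by
    simp only [normSq_coord, div_eq_inv_mul]
    rw [Dp_const_mul _ (ContDiff.sum fun l _ => (Sm_coord x l).pow 2),
      Dp_sum _ (fun l => (Sm_coord x l).pow 2)]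
    simp [Dp_sq (Sm_coord x _), Dp_coord]
  have hd : HasDerivAt φ (deriv φ (‖y - x‖ ^ 2 / ρ ^ 2)) (‖y - x‖ ^ 2 / ρ ^ 2) :=
    (hφ.differentiable (by simp)).differentiableAt.hasDerivAt
  have := (hd.comp_hasFDerivAt y (h1.diff y).hasFDerivAt).fderiv
  rw [← h2]
  unfold Dp
  have e : (fun y : E3 => φ (‖y - x‖ ^ 2 / ρ ^ 2)) = φ ∘ (fun y : E3 => ‖y - x‖ ^ 2 / ρ ^ 2) := rfl
  rw [e, this]
  simp

lemma int_Dp_zero {g : E3 → ℝ} (hg : Sm g) (hc : HasCompactSupport g) (k : Fin 3) :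
    ∫ y, Dp k g y = 0 := by
  have h1 : Integrable g := hg.continuous.integrable_of_hasCompactSupport hc
  have h2 : HasCompactSupport (Dp k g) := hc.fderiv_apply ℝ _
  have h3 : Integrable (Dp k g) := (hg.Dp k).continuous.integrable_of_hasCompactSupport h2
  have := integral_mul_fderiv_eq_neg_fderiv_mul_of_integrable (μ := (volume : Measure E3))
    (f := fun _ : E3 => (1 : ℝ)) (g := g) (v := EuclideanSpace.single k (1 : ℝ))
    (by simp) (by simpa [Dp] using! h3) (by simpa using h1) (by simp) (fun y _ => hg.diff y)
  simpa [Dp] using! this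

section poh
variable {ι : Type*}

def Wf (q : ι → E3 → ℝ) (x : E3) (i : ι) (y : E3) : ℝ := ∑ l, (y l - x l) * Dp l (q i) y

def ef [Fintype ι] (q : ι → E3 → ℝ) (F : E3 → ℝ) (y : E3) : ℝ := 1 / 2 * (∑ i, ∑ k, Dp k (q i) y ^ 2) + F y

lemma Sm_Wf {q : ι → E3 → ℝ} (hq : ∀ i, Sm (q i)) (x : E3) (i : ι) : Sm (Wf q x i) :=
  ContDiff.sum fun l _ => (Sm_coord x l).mul ((hq i).Dp l)

lemma Sm_ef [Fintype ι] {q : ι → E3 → ℝ} (hq : ∀ i, Sm (q i)) {F : E3 → ℝ} (hF : Sm F) : Sm (ef q F) :=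
  (contDiff_const.mul (ContDiff.sum fun i _ => ContDiff.sum fun k _ => ((hq i).Dp k).pow 2)).add hF

lemma Dp_Wf {q : ι → E3 → ℝ} (hq : ∀ i, Sm (q i)) (x : E3) (i : ι) (k : Fin 3) (y : E3) :
    Dp k (Wf q x i) y = Dp k (q i) y + ∑ l, (y l - x l) * Dp k (Dp l (q i)) y := by
  unfold Wf
  rw [Dp_sum _ (fun l => (Sm_coord x l).mul ((hq i).Dp l))]
  simp only [Dp_mul (Sm_coord x _) ((hq i).Dp _), Dp_coord, Finset.sum_add_distrib]
  simp

lemma Dp_ef [Fintype ι] {q : ι → E3 → ℝ} (hq : ∀ i, Sm (q i)) {F : E3 → ℝ} (hF : Sm F) (k : Fin 3) (y : E3) :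
    Dp k (ef q F) y = (∑ i, ∑ m, Dp m (q i) y * Dp k (Dp m (q i)) y) + Dp k F y := by
  unfold ef
  have h1 : ∀ i, Sm (fun y => ∑ m, Dp m (q i) y ^ 2) := fun i =>
    ContDiff.sum fun m _ => ((hq i).Dp m).pow 2
  rw [Dp_add (contDiff_const.mul (ContDiff.sum fun i _ => h1 i)) hF,
    Dp_const_mul _ (ContDiff.sum fun i _ => h1 i), Dp_sum _ h1]
  congr 1
  rw [Finset.mul_sum]
  refine Finset.sum_congr rfl fun i _ => ?_
  rw [Dp_sum _ (fun m => ((hq i).Dp m).pow 2), Finset.mul_sum]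
  refine Finset.sum_congr rfl fun m _ => ?_
  rw [Dp_sq ((hq i).Dp m)]; ring

/-- The vector field of the Pohozaev identity. -/
def Vf [Fintype ι] (q : ι → E3 → ℝ) (F : E3 → ℝ) (x : E3) (ψ : E3 → ℝ) (k : Fin 3) (y : E3) : ℝ :=
  (ef q F y * (y k - x k) - ∑ i, Dp k (q i) y * Wf q x i y) * ψ y

lemma div_Vf [Fintype ι] {q : ι → E3 → ℝ} (hq : ∀ i, Sm (q i)) {F : E3 → ℝ} (hF : Sm F) (x : E3)
    {φ : ℝ → ℝ} (hφ : ContDiff ℝ (⊤ : ℕ∞) φ) (ρ : ℝ) (y : E3) :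
    ∑ k, Dp k (Vf q F x (fun y => φ (‖y - x‖ ^ 2 / ρ ^ 2)) k) y =
      (ef q F y + 2 * F y) * φ (‖y - x‖ ^ 2 / ρ ^ 2)
      + 2 / ρ ^ 2 * deriv φ (‖y - x‖ ^ 2 / ρ ^ 2) *
        (ef q F y * ‖y - x‖ ^ 2 - ∑ i, Wf q x i y ^ 2)
      + φ (‖y - x‖ ^ 2 / ρ ^ 2) * ∑ l, (y l - x l) *
        (Dp l F y - ∑ i, (∑ k, Dp k (Dp k (q i)) y) * Dp l (q i) y) := by
  have hψ := Sm_cut hφ x ρ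
  have hA : ∀ k, Sm (fun y => ef q F y * (y k - x k)) := fun k => (Sm_ef hq hF).mul (Sm_coord x k)
  have hB0 : ∀ k i, Sm (fun y => Dp k (q i) y * Wf q x i y) := fun k i =>
    ((hq i).Dp k).mul (Sm_Wf hq x i)
  have hB : ∀ k, Sm (fun y => ∑ i, Dp k (q i) y * Wf q x i y) := fun k =>
    ContDiff.sum fun i _ => hB0 k i
  have hk : ∀ k, Dp k (Vf q F x (fun y => φ (‖y - x‖ ^ 2 / ρ ^ 2)) k) y =
      (((∑ i, ∑ m, Dp m (q i) y * Dp k (Dp m (q i)) y) + Dp k F y) * (y k - x k) + ef q F y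
        - ∑ i, (Dp k (Dp k (q i)) y * Wf q x i y + Dp k (q i) y *
          (Dp k (q i) y + ∑ l, (y l - x l) * Dp k (Dp l (q i)) y))) * φ (‖y - x‖ ^ 2 / ρ ^ 2)
      + (ef q F y * (y k - x k) - ∑ i, Dp k (q i) y * Wf q x i y) *
        (deriv φ (‖y - x‖ ^ 2 / ρ ^ 2) * (2 * (y k - x k) / ρ ^ 2)) := by
    intro k
    unfold Vf
    rw [Dp_mul ((hA k).sub (hB k)) hψ, Dp_cut hφ, Dp_sub (hA k) (hB k), Dp_sum _ (hB0 k),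
      Dp_mul (Sm_ef hq hF) (Sm_coord x k), Dp_ef hq hF, Dp_coord, if_pos rfl, mul_one]
    congr 4
    ext i
    rw [Dp_mul ((hq i).Dp k) (Sm_Wf hq x i), Dp_Wf hq]
  simp only [hk]
  have key : ∀ i, Wf q x i y = ∑ l, (y l - x l) * Dp l (q i) y := fun i => rfl
  have he : ef q F y = 1 / 2 * (∑ i, ∑ k, Dp k (q i) y ^ 2) + F y := rfl
  have hn := normSq_coord x y
  generalize φ (‖y - x‖ ^ 2 / ρ ^ 2) = P
  generalize deriv φ (‖y - x‖ ^ 2 / ρ ^ 2) = P'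
  rw [hn]
  have h01 : ∀ i, Dp 1 (Dp 0 (q i)) y = Dp 0 (Dp 1 (q i)) y := fun i => Dp_comm (hq i) _ _ _
  have h02 : ∀ i, Dp 2 (Dp 0 (q i)) y = Dp 0 (Dp 2 (q i)) y := fun i => Dp_comm (hq i) _ _ _
  have h12 : ∀ i, Dp 2 (Dp 1 (q i)) y = Dp 1 (Dp 2 (q i)) y := fun i => Dp_comm (hq i) _ _ _
  simp only [Fin.sum_univ_three] at key he ⊢
  simp only [h01, h02, h12]
  have r1 : (y 0 - x 0) * (∑ i, Dp 0 (q i) y * Wf q x i y) + (y 1 - x 1) * (∑ i, Dp 1 (q i) y * Wf q x i y)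
      + (y 2 - x 2) * (∑ i, Dp 2 (q i) y * Wf q x i y) - ∑ i, Wf q x i y ^ 2 = 0 := by
    simp only [Finset.mul_sum, ← Finset.sum_add_distrib, ← Finset.sum_sub_distrib]
    refine Finset.sum_eq_zero fun i _ => ?_
    rw [key i]; ring
  have r2 : (y 0 - x 0) * (∑ i, (Dp 0 (q i) y * Dp 0 (Dp 0 (q i)) y + Dp 1 (q i) y * Dp 0 (Dp 1 (q i)) y + Dp 2 (q i) y * Dp 0 (Dp 2 (q i)) y))
      + (y 1 - x 1) * (∑ i, (Dp 0 (q i) y * Dp 0 (Dp 1 (q i)) y + Dp 1 (q i) y * Dp 1 (Dp 1 (q i)) y + Dp 2 (q i) y * Dp 1 (Dp 2 (q i)) y))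
      + (y 2 - x 2) * (∑ i, (Dp 0 (q i) y * Dp 0 (Dp 2 (q i)) y + Dp 1 (q i) y * Dp 1 (Dp 2 (q i)) y + Dp 2 (q i) y * Dp 2 (Dp 2 (q i)) y))
      - (∑ i, (Dp 0 (Dp 0 (q i)) y * Wf q x i y + Dp 0 (q i) y * (Dp 0 (q i) y + ((y 0 - x 0) * Dp 0 (Dp 0 (q i)) y + (y 1 - x 1) * Dp 0 (Dp 1 (q i)) y + (y 2 - x 2) * Dp 0 (Dp 2 (q i)) y))))
      - (∑ i, (Dp 1 (Dp 1 (q i)) y * Wf q x i y + Dp 1 (q i) y * (Dp 1 (q i) y + ((y 0 - x 0) * Dp 0 (Dp 1 (q i)) y + (y 1 - x 1) * Dp 1 (Dp 1 (q i)) y + (y 2 - x 2) * Dp 1 (Dp 2 (q i)) y))))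
      - (∑ i, (Dp 2 (Dp 2 (q i)) y * Wf q x i y + Dp 2 (q i) y * (Dp 2 (q i) y + ((y 0 - x 0) * Dp 0 (Dp 2 (q i)) y + (y 1 - x 1) * Dp 1 (Dp 2 (q i)) y + (y 2 - x 2) * Dp 2 (Dp 2 (q i)) y))))
      + (∑ i, (Dp 0 (q i) y ^ 2 + Dp 1 (q i) y ^ 2 + Dp 2 (q i) y ^ 2))
      + (y 0 - x 0) * (∑ i, (Dp 0 (Dp 0 (q i)) y + Dp 1 (Dp 1 (q i)) y + Dp 2 (Dp 2 (q i)) y) * Dp 0 (q i) y)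
      + (y 1 - x 1) * (∑ i, (Dp 0 (Dp 0 (q i)) y + Dp 1 (Dp 1 (q i)) y + Dp 2 (Dp 2 (q i)) y) * Dp 1 (q i) y)
      + (y 2 - x 2) * (∑ i, (Dp 0 (Dp 0 (q i)) y + Dp 1 (Dp 1 (q i)) y + Dp 2 (Dp 2 (q i)) y) * Dp 2 (q i) y) = 0 := by
    simp only [Finset.mul_sum, ← Finset.sum_add_distrib, ← Finset.sum_sub_distrib]
    refine Finset.sum_eq_zero fun i _ => ?_
    rw [key i]; ring
  have he2 : (∑ i, (Dp 0 (q i) y ^ 2 + Dp 1 (q i) y ^ 2 + Dp 2 (q i) y ^ 2)) = 2 * (ef q F y - F y) := by rw [he]; ring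
  linear_combination P * r2 - P * he2 - 2 / ρ ^ 2 * P' * r1

end poh

lemma cut_arg {x y : E3} {ρ : ℝ} (hρ : 0 < ρ) (hy : y ∉ ball x (Real.sqrt 10 * ρ)) :
    10 ≤ ‖y - x‖ ^ 2 / ρ ^ 2 := by
  rw [mem_ball, dist_eq_norm, not_lt] at hy
  rw [le_div_iff₀ (by positivity)]
  have h := pow_le_pow_left₀ (by positivity) hy 2
  rw [mul_pow, Real.sq_sqrt (by norm_num)] at h
  exact h

lemma cut_supp {θ : ℝ → ℝ} (hθ : ∀ t, 10 ≤ t → θ t = 0) (h : E3 → ℝ) (x : E3) {ρ : ℝ}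
    (hρ : 0 < ρ) : HasCompactSupport (fun y => h y * θ (‖y - x‖ ^ 2 / ρ ^ 2)) := by
  apply HasCompactSupport.intro (isCompact_closedBall x (Real.sqrt 10 * ρ))
  intro y hy
  rw [hθ _ (cut_arg hρ fun h => hy (ball_subset_closedBall h)), mul_zero]

lemma cut_cont {θ : ℝ → ℝ} (hc : Continuous θ) {h : E3 → ℝ} (hh : Continuous h) (x : E3) (ρ : ℝ) :
    Continuous (fun y => h y * θ (‖y - x‖ ^ 2 / ρ ^ 2)) := by
  fun_prop

lemma cut_int {θ : ℝ → ℝ} (hc : Continuous θ) (hθ : ∀ t, 10 ≤ t → θ t = 0) {h : E3 → ℝ}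
    (hh : Continuous h) (x : E3) {ρ : ℝ} (hρ : 0 < ρ) :
    Integrable (fun y => h y * θ (‖y - x‖ ^ 2 / ρ ^ 2)) :=
  (cut_cont hc hh x ρ).integrable_of_hasCompactSupport (cut_supp hθ h x hρ)

lemma cut_setInt {θ : ℝ → ℝ} (hθ : ∀ t, 10 ≤ t → θ t = 0) (h : E3 → ℝ) (x : E3) {ρ : ℝ}
    (hρ : 0 < ρ) : ∫ y in ball x (Real.sqrt 10 * ρ), h y * θ (‖y - x‖ ^ 2 / ρ ^ 2) =
      ∫ y, h y * θ (‖y - x‖ ^ 2 / ρ ^ 2) := by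
  apply setIntegral_eq_integral_of_forall_compl_eq_zero
  intro y hy
  rw [hθ _ (cut_arg hρ hy), mul_zero]

lemma deriv_cut_zero {φ : ℝ → ℝ} (hφ : AdmissibleCutoff φ) : ∀ t, 10 ≤ t → deriv φ t = 0 := by
  intro t ht
  apply IsLocalMin.deriv_eq_zero
  refine Filter.Eventually.of_forall fun s => ?_
  rw [hφ.2.2.1 t ht]
  exact hφ.2.1 s

lemma pohozaev {ι : Type*} [Fintype ι] {q : ι → E3 → ℝ} (hq : ∀ i, Sm (q i)) {F : E3 → ℝ}
    (hF : Sm F) (x : E3) {φ : ℝ → ℝ} (hφ : AdmissibleCutoff φ) {ρ : ℝ} (hρ : 0 < ρ)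
    (hEL : ∀ y ∈ ball x (Real.sqrt 10 * ρ), ∀ l,
      Dp l F y = ∑ i, (∑ k, Dp k (Dp k (q i)) y) * Dp l (q i) y) :
    (∫ y, ef q F y * φ (‖y - x‖ ^ 2 / ρ ^ 2)) + 2 * (∫ y, F y * φ (‖y - x‖ ^ 2 / ρ ^ 2))
      + 2 / ρ ^ 2 * (∫ y, (ef q F y * ‖y - x‖ ^ 2) * deriv φ (‖y - x‖ ^ 2 / ρ ^ 2))
      - 2 / ρ ^ 2 * (∫ y, (∑ i, Wf q x i y ^ 2) * deriv φ (‖y - x‖ ^ 2 / ρ ^ 2)) = 0 := by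
  have hφs := hφ.1
  have hφ0 := hφ.2.2.1
  have hφ1 := deriv_cut_zero hφ
  have hφc : Continuous φ := hφs.continuous
  have hφdc : Continuous (deriv φ) := hφs.continuous_deriv (by simp)
  have he : Continuous (ef q F) := (Sm_ef hq hF).continuous
  have hW : Continuous (fun y => ∑ i, Wf q x i y ^ 2) :=
    continuous_finsetSum _ fun i _ => (Sm_Wf hq x i).continuous.pow 2
  have hV : ∀ k, Sm (Vf q F x (fun y => φ (‖y - x‖ ^ 2 / ρ ^ 2)) k) := fun k =>
    (((Sm_ef hq hF).mul (Sm_coord x k)).sub (ContDiff.sum fun i _ =>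
      ((hq i).Dp k).mul (Sm_Wf hq x i))).mul (Sm_cut hφs x ρ)
  have hVc : ∀ k, HasCompactSupport (Vf q F x (fun y => φ (‖y - x‖ ^ 2 / ρ ^ 2)) k) := fun k =>
    cut_supp hφ0 _ x hρ
  have hVi : ∀ k, Integrable (Dp k (Vf q F x (fun y => φ (‖y - x‖ ^ 2 / ρ ^ 2)) k)) := fun k =>
    ((hV k).Dp k).continuous.integrable_of_hasCompactSupport ((hVc k).fderiv_apply ℝ _)
  have h0 : ∫ y, ∑ k, Dp k (Vf q F x (fun y => φ (‖y - x‖ ^ 2 / ρ ^ 2)) k) y = 0 := by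
    rw [integral_finsetSum _ (fun k _ => hVi k)]
    exact Finset.sum_eq_zero fun k _ => int_Dp_zero (hV k) (hVc k) k
  have i1 := cut_int hφc hφ0 he x hρ
  have i2 := cut_int hφc hφ0 hF.continuous x hρ
  have i3 := cut_int (h := fun y => ef q F y * ‖y - x‖ ^ 2) hφdc hφ1 (by fun_prop) x hρ
  have i4 := cut_int hφdc hφ1 hW x hρ
  have j2 := i2.const_mul 2
  have j3 := i3.const_mul (2 / ρ ^ 2)
  have j4 := i4.const_mul (2 / ρ ^ 2)
  have k1 : Integrable (fun y => ef q F y * φ (‖y - x‖ ^ 2 / ρ ^ 2)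
      + 2 * (F y * φ (‖y - x‖ ^ 2 / ρ ^ 2))) := i1.add j2
  have k2 : Integrable (fun y => ef q F y * φ (‖y - x‖ ^ 2 / ρ ^ 2)
      + 2 * (F y * φ (‖y - x‖ ^ 2 / ρ ^ 2))
      + 2 / ρ ^ 2 * ((ef q F y * ‖y - x‖ ^ 2) * deriv φ (‖y - x‖ ^ 2 / ρ ^ 2))) := k1.add j3
  rw [← integral_const_mul, ← integral_const_mul, ← integral_const_mul,
    ← integral_add i1 j2, ← integral_add k1 j3, ← integral_sub k2 j4, ← h0]
  congr 1
  ext y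
  rw [div_Vf hq hF x hφs ρ y]
  by_cases hy : y ∈ ball x (Real.sqrt 10 * ρ)
  · simp only [hEL y hy, sub_self, mul_zero, Finset.sum_const_zero]
    ring
  · simp only [hφ0 _ (cut_arg hρ hy), hφ1 _ (cut_arg hρ hy)]
    simp

lemma deriv_int {e : E3 → ℝ} (he : Continuous e) (x : E3) {φ : ℝ → ℝ} (hφ : AdmissibleCutoff φ)
    {ρ : ℝ} (hρ : 0 < ρ) :
    HasDerivAt (fun s => ∫ y, e y * φ (‖y - x‖ ^ 2 / s ^ 2))
      (∫ y, (e y * (‖y - x‖ ^ 2 * (-2 / ρ ^ 3))) * deriv φ (‖y - x‖ ^ 2 / ρ ^ 2)) ρ := by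
  have hφs := hφ.1
  have hφ0 := hφ.2.2.1
  have hφ1 := deriv_cut_zero hφ
  have hφc : Continuous φ := hφs.continuous
  have hφdc : Continuous (deriv φ) := hφs.continuous_deriv (by simp)
  have hs : Ioo (ρ / 2) (2 * ρ) ∈ nhds ρ := Ioo_mem_nhds (by linarith) (by linarith)
  refine (hasDerivAt_integral_of_dominated_loc_of_deriv_le
    (F := fun s y => e y * φ (‖y - x‖ ^ 2 / s ^ 2))
    (F' := fun s y => (e y * (‖y - x‖ ^ 2 * (-2 / s ^ 3))) * deriv φ (‖y - x‖ ^ 2 / s ^ 2))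
    (bound := (closedBall x (Real.sqrt 10 * (2 * ρ))).indicator fun y => |e y| * (4000 / ρ))
    hs ?_ ?_ ?_ ?_ ?_ ?_).2
  · exact Filter.Eventually.of_forall fun s => (cut_cont hφc he x s).aestronglyMeasurable
  · exact cut_int hφc hφ0 he x hρ
  · exact (cut_cont hφdc (h := fun y => e y * (‖y - x‖ ^ 2 * (-2 / ρ ^ 3)))
      (by fun_prop) x ρ).aestronglyMeasurable
  · refine Filter.Eventually.of_forall fun y s hs => ?_
    have hs0 : 0 < s := by linarith [hs.1]
    by_cases hy : y ∈ ball x (Real.sqrt 10 * s)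
    · have hy' : y ∈ closedBall x (Real.sqrt 10 * (2 * ρ)) := by
        apply ball_subset_closedBall
        refine ball_subset_ball ?_ hy
        have := hs.2
        gcongr
      rw [indicator_of_mem hy', Real.norm_eq_abs, abs_mul, abs_mul, mul_assoc]
      apply mul_le_mul_of_nonneg_left _ (abs_nonneg _)
      have hb : |deriv φ (‖y - x‖ ^ 2 / s ^ 2)| ≤ 100 := hφ.2.2.2.2.2.1 _ (by positivity)
      have hn : ‖y - x‖ ^ 2 ≤ 10 * s ^ 2 := by
        rw [mem_ball, dist_eq_norm] at hy
        have h := pow_le_pow_left₀ (by positivity) hy.le 2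
        rwa [mul_pow, Real.sq_sqrt (by norm_num)] at h
      have h3 : |‖y - x‖ ^ 2 * (-2 / s ^ 3)| ≤ 40 / ρ := by
        rw [abs_mul, abs_of_nonneg (by positivity : 0 ≤ ‖y - x‖ ^ 2), abs_div, abs_neg,
          abs_of_pos (by positivity : 0 < s ^ 3), abs_of_pos (by norm_num : (0 : ℝ) < 2)]
        calc ‖y - x‖ ^ 2 * (2 / s ^ 3) ≤ 10 * s ^ 2 * (2 / s ^ 3) := by gcongr
          _ = 20 / s := by field_simp; norm_num
          _ ≤ 20 / (ρ / 2) := by have := hs.1; gcongr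
          _ = 40 / ρ := by field_simp; norm_num
      calc _ ≤ 40 / ρ * 100 := by gcongr
        _ = _ := by ring
    · rw [hφ1 _ (cut_arg hs0 hy), mul_zero, norm_zero]
      apply indicator_nonneg
      intro y _; positivity
  · rw [integrable_indicator_iff measurableSet_closedBall]
    exact ContinuousOn.integrableOn_compact (isCompact_closedBall _ _) (by fun_prop)
  · refine Filter.Eventually.of_forall fun y s hs => ?_
    have hs0 : 0 < s := by linarith [hs.1]
    have hd : HasDerivAt φ (deriv φ (‖y - x‖ ^ 2 / s ^ 2)) (‖y - x‖ ^ 2 / s ^ 2) :=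
      (hφs.differentiable (by simp)).differentiableAt.hasDerivAt
    have h1 : HasDerivAt (fun s : ℝ => ‖y - x‖ ^ 2 / s ^ 2) (‖y - x‖ ^ 2 * (-2 / s ^ 3)) s := by
      have := ((hasDerivAt_pow 2 s).inv (by positivity)).const_mul (‖y - x‖ ^ 2)
      refine this.congr_deriv ?_
      field_simp
      norm_num
      ring
    refine ((hd.comp s h1).const_mul (e y)).congr_deriv ?_
    ring

lemma deriv_theta {ι : Type*} [Fintype ι] {q : ι → E3 → ℝ} (hq : ∀ i, Sm (q i)) {F : E3 → ℝ}
    (hF : Sm F) (x : E3) {φ : ℝ → ℝ} (hφ : AdmissibleCutoff φ) {ρ : ℝ} (hρ : 0 < ρ)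
    (hEL : ∀ y ∈ ball x (Real.sqrt 10 * ρ), ∀ l,
      Dp l F y = ∑ i, (∑ k, Dp k (Dp k (q i)) y) * Dp l (q i) y) :
    HasDerivAt (fun s => s⁻¹ * ∫ y, ef q F y * φ (‖y - x‖ ^ 2 / s ^ 2))
      (-(2 / ρ ^ 4) * (∫ y, (∑ i, Wf q x i y ^ 2) * deriv φ (‖y - x‖ ^ 2 / ρ ^ 2))
        + 2 / ρ ^ 2 * (∫ y, F y * φ (‖y - x‖ ^ 2 / ρ ^ 2))) ρ := by
  have h1 := (hasDerivAt_inv hρ.ne').mul (deriv_int (Sm_ef hq hF).continuous x hφ hρ)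
  have h2 := pohozaev hq hF x hφ hρ hEL
  have h3 : ∫ y, (ef q F y * (‖y - x‖ ^ 2 * (-2 / ρ ^ 3))) * deriv φ (‖y - x‖ ^ 2 / ρ ^ 2) =
      (-2 / ρ ^ 3) * ∫ y, (ef q F y * ‖y - x‖ ^ 2) * deriv φ (‖y - x‖ ^ 2 / ρ ^ 2) := by
    rw [← integral_const_mul]
    congr 1; ext y; ring
  rw [h3] at h1
  refine h1.congr_deriv ?_
  generalize (∫ y, ef q F y * φ (‖y - x‖ ^ 2 / ρ ^ 2)) = A at h2 ⊢
  generalize (∫ y, F y * φ (‖y - x‖ ^ 2 / ρ ^ 2)) = B at h2 ⊢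
  generalize (∫ y, (ef q F y * ‖y - x‖ ^ 2) * deriv φ (‖y - x‖ ^ 2 / ρ ^ 2)) = C at h2 ⊢
  generalize (∫ y, (∑ i, Wf q x i y ^ 2) * deriv φ (‖y - x‖ ^ 2 / ρ ^ 2)) = D at h2 ⊢
  have h4 : A = -2 * B - 2 / ρ ^ 2 * C + 2 / ρ ^ 2 * D := by linarith
  rw [h4]
  field_simp
  ring

/-- Components of a matrix field. -/
def qf (P : E3 → M3) (p : Fin 3 × Fin 3) (y : E3) : ℝ := P y p.1 p.2

/-- Rescaled potential. -/
def Ff (a b c ε : ℝ) (P : E3 → M3) (y : E3) : ℝ := 1 / ε ^ 2 * fbulk a b c (P y)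

lemma pd_apply (P : E3 → M3) (k i j : Fin 3) (y : E3) : pd P k y i j = Dp k (qf P (i, j)) y := rfl

lemma lapM_apply (P : E3 → M3) (i j : Fin 3) (y : E3) :
    lapM P y i j = ∑ k, Dp k (Dp k (qf P (i, j))) y := by
  unfold lapM
  rw [Matrix.sum_apply]
  rfl

lemma eDen_eq (a b c ε : ℝ) (P : E3 → M3) (y : E3) :
    eDen a b c ε P y = ef (qf P) (Ff a b c ε P) y := by
  unfold eDen ef Ff gradSq frobSq
  simp only [pd_apply, Fintype.sum_prod_type]
  congr 2
  rw [Finset.sum_comm]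
  refine Finset.sum_congr rfl fun i _ => ?_
  rw [Finset.sum_comm]

lemma frob_dirD (P : E3 → M3) (x : E3) (ρ : ℝ) (y : E3) :
    frobSq (dirD P (ρ⁻¹ • (y - x)) y) = (1 / ρ ^ 2) * ∑ p, Wf (qf P) x p y ^ 2 := by
  have h : ∀ i j, dirD P (ρ⁻¹ • (y - x)) y i j = ρ⁻¹ * Wf (qf P) x (i, j) y := by
    intro i j
    unfold dirD Wf
    rw [Matrix.sum_apply, Finset.mul_sum]
    refine Finset.sum_congr rfl fun k _ => ?_
    simp only [Matrix.smul_apply, pd_apply, smul_eq_mul, PiLp.smul_apply, PiLp.sub_apply]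
    ring
  unfold frobSq
  simp only [h, Fintype.sum_prod_type, Finset.mul_sum]
  refine Finset.sum_congr rfl fun i _ => Finset.sum_congr rfl fun j _ => ?_
  field_simp

lemma tr2_eq (A : M3) : (A * A).trace = ∑ i, ∑ j, A i j * A j i := by
  simp [Matrix.trace, Matrix.mul_apply]

lemma tr3_eq (A : M3) : (A * A * A).trace = ∑ i, ∑ j, (∑ k, A i k * A k j) * A j i := by
  simp [Matrix.trace, Matrix.mul_apply]

lemma Sm_tr2 {P : E3 → M3} (hP : ∀ p, Sm (qf P p)) : Sm (fun y => (P y * P y).trace) := by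
  simp only [tr2_eq]
  exact ContDiff.sum fun i _ => ContDiff.sum fun j _ => (hP (i, j)).mul (hP (j, i))

lemma Sm_tr3 {P : E3 → M3} (hP : ∀ p, Sm (qf P p)) : Sm (fun y => (P y * P y * P y).trace) := by
  simp only [tr3_eq]
  exact ContDiff.sum fun i _ => ContDiff.sum fun j _ =>
    (ContDiff.sum fun k _ => (hP (i, k)).mul (hP (k, j))).mul (hP (j, i))

lemma Sm_Ff {P : E3 → M3} (hP : ∀ p, Sm (qf P p)) (a b c ε : ℝ) : Sm (Ff a b c ε P) := by
  unfold Ff fbulk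
  exact contDiff_const.mul (((contDiff_const.sub (contDiff_const.mul (Sm_tr2 hP))).sub
    (contDiff_const.mul (Sm_tr3 hP))).add (contDiff_const.mul ((Sm_tr2 hP).pow 2)))

lemma Dp_tr2 {P : E3 → M3} (hP : ∀ p, Sm (qf P p)) (l : Fin 3) (y : E3) :
    Dp l (fun y => (P y * P y).trace) y = 2 * (P y * pd P l y).trace := by
  have hm : ∀ i j i' j', Sm (fun y => P y i j * P y i' j') := fun i j i' j' =>
    (hP (i, j)).mul (hP (i', j'))
  have hd : ∀ i j i' j', Dp l (fun y => P y i j * P y i' j') y =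
      pd P l y i j * P y i' j' + P y i j * pd P l y i' j' := fun i j i' j' =>
    Dp_mul (hP (i, j)) (hP (i', j')) l y
  simp only [tr2_eq]
  rw [Dp_sum _ (fun i => ContDiff.sum fun j _ => hm i j j i)]
  simp only [Dp_sum _ (fun j => hm _ j j _), hd]
  simp only [Matrix.trace, Matrix.mul_apply, Fin.sum_univ_three, Matrix.diag_apply]
  ring

lemma Dp_tr3 {P : E3 → M3} (hP : ∀ p, Sm (qf P p)) (l : Fin 3) (y : E3) :
    Dp l (fun y => (P y * P y * P y).trace) y = 3 * (P y * P y * pd P l y).trace := by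
  have hm : ∀ i j i' j', Sm (fun y => P y i j * P y i' j') := fun i j i' j' =>
    (hP (i, j)).mul (hP (i', j'))
  have hd : ∀ i j i' j', Dp l (fun y => P y i j * P y i' j') y =
      pd P l y i j * P y i' j' + P y i j * pd P l y i' j' := fun i j i' j' =>
    Dp_mul (hP (i, j)) (hP (i', j')) l y
  have hs : ∀ i j, Sm (fun y => ∑ k, P y i k * P y k j) := fun i j =>
    ContDiff.sum fun k _ => hm i k k j
  have hm3 : ∀ i j, Sm (fun y => (∑ k, P y i k * P y k j) * P y j i) := fun i j =>
    (hs i j).mul (hP (j, i))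
  have hd3 : ∀ i j, Dp l (fun y => (∑ k, P y i k * P y k j) * P y j i) y =
      (∑ k, (pd P l y i k * P y k j + P y i k * pd P l y k j)) * P y j i +
        (∑ k, P y i k * P y k j) * pd P l y j i := by
    intro i j
    refine (Dp_mul (hs i j) (hP (j, i)) l y).trans ?_
    rw [Dp_sum _ (fun k => hm i k k j)]
    simp only [hd]
    rfl
  simp only [tr3_eq]
  rw [Dp_sum _ (fun i => ContDiff.sum fun j _ => hm3 i j)]
  simp only [Dp_sum _ (fun j => hm3 _ j), hd3]
  simp only [Matrix.trace, Matrix.mul_apply, Fin.sum_univ_three, Matrix.diag_apply]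
  ring

lemma Dp_Ff {P : E3 → M3} (hP : ∀ p, Sm (qf P p)) (a b c ε : ℝ) (l : Fin 3) (y : E3) :
    Dp l (Ff a b c ε P) y = 1 / ε ^ 2 * (-a * (P y * pd P l y).trace
      - b * (P y * P y * pd P l y).trace
      + c * (P y * P y).trace * (P y * pd P l y).trace) := by
  have h2 := Sm_tr2 hP
  have h3 := Sm_tr3 hP
  have s1 : Sm (fun y => kconst a b c - a / 2 * (P y * P y).trace) :=
    contDiff_const.sub (contDiff_const.mul h2)
  have s2 : Sm (fun y => b / 3 * (P y * P y * P y).trace) := contDiff_const.mul h3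
  have s3 : Sm (fun y => c / 4 * (P y * P y).trace ^ 2) := contDiff_const.mul (h2.pow 2)
  unfold Ff fbulk
  rw [Dp_const_mul _ ((s1.sub s2).add s3), Dp_add (s1.sub s2) s3, Dp_sub s1 s2,
    Dp_sub contDiff_const (contDiff_const.mul h2), Dp_const_mul _ h2, Dp_const_mul _ h3,
    Dp_const_mul _ (h2.pow 2), Dp_sq h2, Dp_tr2 hP, Dp_tr3 hP]
  have : Dp l (fun _ => kconst a b c) y = 0 := by simp [Dp]
  rw [this]
  ring

lemma EL_contract (a b c ε : ℝ) (hε : 0 < ε) (A L d : M3) (hA : A.IsSymm) (hd : d.trace = 0)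
    (h : (-(ε ^ 2)) • L - a • A - b • (A * A)
      + (b / 3 * normSqM A) • (1 : M3) + (c * normSqM A) • A = 0) :
    ∑ i, ∑ j, L i j * d i j = 1 / ε ^ 2 * (-a * (A * d).trace - b * (A * A * d).trace
      + c * (A * A).trace * (A * d).trace) := by
  have hε2 : ε ^ 2 ≠ 0 := by positivity
  have hL : L = (1 / ε ^ 2) • ((-a) • A - b • (A * A) + (b / 3 * normSqM A) • (1 : M3)
      + (c * normSqM A) • A) := by
    have : (ε ^ 2) • L = (-a) • A - b • (A * A) + (b / 3 * normSqM A) • (1 : M3)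
      + (c * normSqM A) • A := by
      rw [← sub_eq_zero, ← neg_eq_zero, ← h]
      module
    rw [← this, smul_smul, one_div, inv_mul_cancel₀ hε2, one_smul]
  have hLs : Lᵀ = L := by
    have hA' : Aᵀ = A := hA
    rw [hL]
    simp [Matrix.transpose_mul, hA']
  have h1 : ∑ i, ∑ j, L i j * d i j = (L * d).trace := by
    conv_rhs => rw [← hLs]
    simp only [Matrix.trace, Matrix.diag_apply, Matrix.mul_apply, Matrix.transpose_apply]
    rw [Finset.sum_comm]
  rw [h1, hL]
  simp only [Matrix.smul_mul, Matrix.add_mul, Matrix.sub_mul, Matrix.trace_smul, Matrix.trace_add,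
    Matrix.trace_sub, Matrix.one_mul, hd, smul_eq_mul, mul_zero, normSqM]
  ring

lemma EL_global (a b c ε : ℝ) (hε : 0 < ε) {P : E3 → M3} (hP : ∀ p, Sm (qf P p)) {U : Set E3}
    (hU : IsOpen U) (hS : ∀ y ∈ U, P y ∈ S0) (hEL : ∀ y ∈ U, ELeq a b c ε P y) {y : E3} (hy : y ∈ U)
    (l : Fin 3) : Dp l (Ff a b c ε P) y =
      ∑ p, (∑ k, Dp k (Dp k (qf P p)) y) * Dp l (qf P p) y := by
  have htr : (pd P l y).trace = 0 := by
    have h1 : (pd P l y).trace = Dp l (fun y => ∑ i, P y i i) y :=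
      (Dp_sum Finset.univ (fun i => hP (i, i)) l y).symm
    have h2 : (fun y => ∑ i, P y i i) =ᶠ[nhds y] fun _ => (0 : ℝ) := by
      filter_upwards [hU.mem_nhds hy] with z hz
      exact (hS z hz).2
    rw [h1, Dp, h2.fderiv_eq]
    simp
  rw [Dp_Ff hP, ← EL_contract a b c ε hε (P y) (lapM P y) (pd P l y) (hS y hy).1 htr (hEL y hy),
    Fintype.sum_prod_type]
  simp only [lapM_apply, pd_apply]

/-- Right-hand side of the monotonicity formula. -/
def rhsM (a b c ε : ℝ) (φ : ℝ → ℝ) (Q : E3 → M3) (x : E3) (ρ : ℝ) : ℝ :=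
  (-(2 / ρ ^ 2) * ∫ y in ball x (Real.sqrt 10 * ρ),
              frobSq (dirD Q (ρ⁻¹ • (y - x)) y) * deriv φ (‖y - x‖ ^ 2 / ρ ^ 2))
            + (2 / (ε ^ 2 * ρ ^ 2)) * ∫ y in ball x (Real.sqrt 10 * ρ),
                fbulk a b c (Q y) * φ (‖y - x‖ ^ 2 / ρ ^ 2)

lemma main_global (a b c ε : ℝ) (hε : 0 < ε) {φ : ℝ → ℝ} (hφ : AdmissibleCutoff φ)
    {P : E3 → M3} (hP : ∀ p, Sm (qf P p)) (x : E3) (D : ℝ)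
    (hS : ∀ y ∈ ball x D, P y ∈ S0) (hEL : ∀ y ∈ ball x D, ELeq a b c ε P y)
    {ρ : ℝ} (hρ : 0 < ρ) (hρD : Real.sqrt 10 * ρ ≤ D) :
    HasDerivAt (fun s => Theta a b c ε φ P x s) (rhsM a b c ε φ P x ρ) ρ := by
  have h := deriv_theta hP (Sm_Ff hP a b c ε) x hφ hρ (fun y hy l =>
    EL_global a b c ε hε hP isOpen_ball hS hEL (ball_subset_ball hρD hy) l)
  have e1 : (fun s => Theta a b c ε φ P x s) =ᶠ[nhds ρ]
      fun s => s⁻¹ * ∫ y, ef (qf P) (Ff a b c ε P) y * φ (‖y - x‖ ^ 2 / s ^ 2) := by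
    filter_upwards [Ioi_mem_nhds hρ] with s hs
    unfold Theta
    rw [cut_setInt hφ.2.2.1 _ x hs]
    simp only [eDen_eq]
  refine (h.congr_of_eventuallyEq e1).congr_deriv ?_
  unfold rhsM
  rw [cut_setInt hφ.2.2.1 _ x hρ, cut_setInt (deriv_cut_zero hφ) _ x hρ]
  simp only [frob_dirD, Ff, mul_assoc, integral_const_mul]
  field_simp

lemma pd_congr {P Q : E3 → M3} {U : Set E3} (hU : IsOpen U) (h : ∀ y ∈ U, P y = Q y) {y : E3}
    (hy : y ∈ U) (k : Fin 3) : pd P k y = pd Q k y := by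
  have h2 : ∀ i j, (fun y => P y i j) =ᶠ[nhds y] fun y => Q y i j := by
    intro i j
    filter_upwards [hU.mem_nhds hy] with z hz
    rw [h z hz]
  ext i j
  exact congrArg (fun L : E3 →L[ℝ] ℝ => L (EuclideanSpace.single k 1)) (h2 i j).fderiv_eq

lemma lapM_congr {P Q : E3 → M3} {U : Set E3} (hU : IsOpen U) (h : ∀ y ∈ U, P y = Q y) {y : E3}
    (hy : y ∈ U) : lapM P y = lapM Q y := by
  unfold lapM
  refine Finset.sum_congr rfl fun k _ => ?_
  have h2 : ∀ i j, (fun y => pd P k y i j) =ᶠ[nhds y] fun y => pd Q k y i j := by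
    intro i j
    filter_upwards [hU.mem_nhds hy] with z hz
    rw [pd_congr hU h hz]
  ext i j
  exact congrArg (fun L : E3 →L[ℝ] ℝ => L (EuclideanSpace.single k 1)) (h2 i j).fderiv_eq

lemma Theta_congr (a b c ε : ℝ) (φ : ℝ → ℝ) {P Q : E3 → M3} {x : E3} {D : ℝ}
    (h : ∀ y ∈ ball x D, P y = Q y) {ρ : ℝ} (hρ : Real.sqrt 10 * ρ ≤ D) :
    Theta a b c ε φ P x ρ = Theta a b c ε φ Q x ρ := by
  unfold Theta
  congr 1
  apply setIntegral_congr_fun measurableSet_ball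
  intro y hy
  have hy' := ball_subset_ball hρ hy
  simp only [eDen, gradSq, pd_congr isOpen_ball h hy', h y hy']

lemma rhsM_congr (a b c ε : ℝ) (φ : ℝ → ℝ) {P Q : E3 → M3} {x : E3} {D : ℝ}
    (h : ∀ y ∈ ball x D, P y = Q y) {ρ : ℝ} (hρ : Real.sqrt 10 * ρ ≤ D) :
    rhsM a b c ε φ P x ρ = rhsM a b c ε φ Q x ρ := by
  unfold rhsM
  congr 2
  · apply setIntegral_congr_fun measurableSet_ball
    intro y hy
    have hy' := ball_subset_ball hρ hy
    simp only [dirD, pd_congr isOpen_ball h hy']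
  · apply setIntegral_congr_fun measurableSet_ball
    intro y hy
    have hy' := ball_subset_ball hρ hy
    simp only [h y hy']

lemma mem_of_lt_infDist {ω : Set E3} {x y : E3} (h : dist y x < infDist x ωᶜ) : y ∈ ω := by
  by_contra hy
  have := infDist_le_dist_of_mem (x := x) (show y ∈ ωᶜ from hy)
  rw [dist_comm] at this
  linarith

lemma hasDerivAt_Theta (a b c ε : ℝ) (ha : 0 ≤ a) (hb : 0 < b) (hc : 0 < c) (hε : 0 < ε)
    (φ : ℝ → ℝ) (hφ : AdmissibleCutoff φ)
    (ω : Set E3) (hω : IsOpen ω) (Q : E3 → M3)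
    (hQsmooth : ContDiffOn ℝ (⊤ : ℕ∞) Q ω) (hQS0 : ∀ x ∈ ω, Q x ∈ S0)
    (hEL : ∀ z ∈ ω, ELeq a b c ε Q z)
    (x : E3) (hd : 0 < infDist x ωᶜ) (ρ : ℝ) (hρ : ρ ∈ Ioo 0 (infDist x ωᶜ / 10)) :
    HasDerivAt (fun s => Theta a b c ε φ Q x s) (rhsM a b c ε φ Q x ρ) ρ ∧
      0 ≤ rhsM a b c ε φ Q x ρ := by
  set d := infDist x ωᶜ with hdd
  obtain ⟨hρ0, hρ1⟩ := hρ
  have hsq : Real.sqrt 10 ≤ 10 / 3 := by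
    rw [Real.sqrt_le_left (by norm_num)]; norm_num
  have hsρ : ∀ s, 0 < s → s < d / 10 → Real.sqrt 10 * s ≤ d / 3 := by
    intro s h0 h1
    calc Real.sqrt 10 * s ≤ 10 / 3 * s := by gcongr
      _ ≤ d / 3 := by linarith
  have hball : ball x (d / 3) ⊆ ω := fun y hy => mem_of_lt_infDist (by
    rw [mem_ball] at hy; linarith)
  let χ : ContDiffBump x := ⟨d / 3, d / 2, by linarith, by linarith⟩
  set P : E3 → M3 := fun y => χ y • Q y with hPdef
  have hPQ : ∀ y ∈ ball x (d / 3), P y = Q y := by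
    intro y hy
    have : χ y = 1 := χ.one_of_mem_closedBall (ball_subset_closedBall hy)
    simp only [hPdef, this, one_smul]
  have hP : ∀ p, Sm (qf P p) := by
    intro p
    refine contDiff_iff_contDiffAt.2 fun y => ?_
    by_cases hy : y ∈ ω
    · have h1 : ContDiffAt ℝ (⊤ : ℕ∞) Q y := hQsmooth.contDiffAt (hω.mem_nhds hy)
      have h2 : ContDiffAt ℝ (⊤ : ℕ∞) (fun y => Q y p.1 p.2) y :=
        contDiffAt_pi.1 (contDiffAt_pi.1 h1 p.1) p.2
      exact (χ.contDiff.contDiffAt).mul h2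
    · have h1 : y ∉ tsupport χ := by
        rw [χ.tsupport_eq]
        intro h
        apply hy
        apply mem_of_lt_infDist
        have : dist y x ≤ d / 2 := h
        linarith
      have h2 := notMem_tsupport_iff_eventuallyEq.1 h1
      have h3 : qf P p =ᶠ[nhds y] fun _ => 0 := by
        filter_upwards [h2] with z hz
        simp [qf, hPdef, hz]
      exact contDiffAt_const.congr_of_eventuallyEq h3
  have hPS : ∀ y ∈ ball x (d / 3), P y ∈ S0 := fun y hy => by
    rw [hPQ y hy]; exact hQS0 y (hball hy)
  have hPE : ∀ y ∈ ball x (d / 3), ELeq a b c ε P y := fun y hy => by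
    unfold ELeq
    rw [hPQ y hy, lapM_congr isOpen_ball hPQ hy]; exact hEL y (hball hy)
  constructor
  · have h := main_global a b c ε hε hφ hP x (d / 3) hPS hPE hρ0 (hsρ ρ hρ0 hρ1)
    rw [rhsM_congr a b c ε φ hPQ (hsρ ρ hρ0 hρ1)] at h
    refine h.congr_of_eventuallyEq ?_
    filter_upwards [Ioo_mem_nhds hρ0 hρ1] with s hs
    exact (Theta_congr a b c ε φ hPQ (hsρ s hs.1 hs.2)).symm
  · unfold rhsM
    apply add_nonneg
    · rw [neg_mul, ← mul_neg, ← integral_neg]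
      apply mul_nonneg (by positivity)
      apply integral_nonneg
      intro y
      have h1 : deriv φ (‖y - x‖ ^ 2 / ρ ^ 2) ≤ 0 := hφ.2.2.2.2.2.2.2 _ (by positivity)
      have h2 : 0 ≤ frobSq (dirD Q (ρ⁻¹ • (y - x)) y) := by
        unfold frobSq; positivity
      simp only [Pi.zero_apply]
      nlinarith
    · apply mul_nonneg (by positivity)
      apply setIntegral_nonneg measurableSet_ball
      intro y hy
      have hy' := hball (ball_subset_ball (hsρ ρ hρ0 hρ1) hy)
      exact mul_nonneg (fbulk_nonneg a b c ha hb hc _ (hQS0 y hy')) (hφ.2.1 _)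

/-- the modified monotonicity formula. -/
theorem stmt3 (a b c ε : ℝ) (ha : 0 ≤ a) (hb : 0 < b) (hc : 0 < c) (hε : 0 < ε)
    (φ : ℝ → ℝ) (hφ : AdmissibleCutoff φ)
    (ω : Set E3) (hω : IsOpen ω) (Q : E3 → M3)
    (hQsmooth : ContDiffOn ℝ (⊤ : ℕ∞) Q ω) (hQS0 : ∀ x ∈ ω, Q x ∈ S0)
    (hEL : ∀ z ∈ ω, ELeq a b c ε Q z)
    (x : E3) (hx : x ∈ ω) (r R : ℝ)
    (hr : 0 < r) (hrR : r < R) (hR : R < infDist x ωᶜ / 10) :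
    (Theta a b c ε φ Q x R - Theta a b c ε φ Q x r
      = ∫ ρ in r..R,
          (-(2 / ρ ^ 2) * ∫ y in ball x (Real.sqrt 10 * ρ),
              frobSq (dirD Q (ρ⁻¹ • (y - x)) y) * deriv φ (‖y - x‖ ^ 2 / ρ ^ 2))
            + (2 / (ε ^ 2 * ρ ^ 2)) * ∫ y in ball x (Real.sqrt 10 * ρ),
                fbulk a b c (Q y) * φ (‖y - x‖ ^ 2 / ρ ^ 2))
    ∧ MonotoneOn (fun ρ => Theta a b c ε φ Q x ρ) (Ioo 0 (infDist x ωᶜ / 10)) := by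
  have hd : 0 < infDist x ωᶜ := by linarith
  have hmono := hasDerivAt_Theta a b c ε ha hb hc hε φ hφ ω hω Q hQsmooth hQS0 hEL x hd
  have hder : ∀ ρ ∈ Ioo 0 (infDist x ωᶜ / 10),
      HasDerivAt (fun s => Theta a b c ε φ Q x s) (rhsM a b c ε φ Q x ρ) ρ :=
    fun ρ hρ => (hmono ρ hρ).1
  have hpos : ∀ ρ ∈ Ioo 0 (infDist x ωᶜ / 10), 0 ≤ rhsM a b c ε φ Q x ρ :=
    fun ρ hρ => (hmono ρ hρ).2
  have hsub : ∀ ρ ∈ Icc r R, ρ ∈ Ioo 0 (infDist x ωᶜ / 10) := fun ρ hρ =>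
    ⟨by linarith [hρ.1], by linarith [hρ.2]⟩
  constructor
  · have hint : IntervalIntegrable (rhsM a b c ε φ Q x) volume r R := by
      apply intervalIntegral.intervalIntegrable_deriv_of_nonneg
        (g := fun s => Theta a b c ε φ Q x s)
      · rw [uIcc_of_le hrR.le]
        exact fun ρ hρ => (hder ρ (hsub ρ hρ)).continuousAt.continuousWithinAt
      · rw [min_eq_left hrR.le, max_eq_right hrR.le]
        exact fun ρ hρ => hder ρ (hsub ρ (Ioo_subset_Icc_self hρ))
      · rw [min_eq_left hrR.le, max_eq_right hrR.le]
        exact fun ρ hρ => hpos ρ (hsub ρ (Ioo_subset_Icc_self hρ))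
    have := intervalIntegral.integral_eq_sub_of_hasDerivAt
      (f := fun s => Theta a b c ε φ Q x s) (f' := rhsM a b c ε φ Q x) (a := r) (b := R)
      (fun ρ hρ => hder ρ (hsub ρ (by rwa [uIcc_of_le hrR.le] at hρ))) hint
    exact this.symm
  · apply monotoneOn_of_deriv_nonneg (convex_Ioo _ _)
    · exact fun ρ hρ => (hder ρ hρ).continuousAt.continuousWithinAt
    · rw [interior_Ioo]
      exact fun ρ hρ => (hder ρ hρ).differentiableAt.differentiableWithinAt
    · rw [interior_Ioo]
      intro ρ hρ
      rw [(hder ρ hρ).deriv]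
      exact hpos ρ hρ

end
end

section
/- For every M > 0 there exists C > 0 depending only on a, b, c, M such that the following holds. For every ε ∈ (0,1), r > 0, x ∈ ℝ³, and every smooth solution Q : B_{2r}(x) → S₀ of the Euler–Lagrange equation −ε²ΔQ − aQ − bQ² + (b/3)|Q|²I + c|Q|²Q = 0 with sup_{B_{2r}(x)} |Q| ≤ M, one has sup_{B_r(x)} |∇Q| ≤ C(1/ε + 1/r). -/
noncomputable section

open Matrix MeasureTheory Metric Set

attribute [local instance] Matrix.normedAddCommGroup Matrix.normedSpace

/-- Second-order necessary condition at a one-dimensional local maximum. -/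
lemma second_nonpos (f f' : ℝ → ℝ) (f'' : ℝ) (hf : ∀ᶠ t in nhds (0:ℝ), HasDerivAt f (f' t) t)
    (hf' : HasDerivAt f' f'' 0) (hmax : IsLocalMax f 0) : f'' ≤ 0 := by
  by_contra hpos
  push Not at hpos
  have hd : deriv f =ᶠ[nhds 0] f' := hf.mono fun t ht => ht.deriv
  have h1 : deriv (deriv f) 0 = f'' := by
    rw [Filter.EventuallyEq.deriv_eq hd]; exact hf'.deriv
  have hmin : IsLocalMin f 0 := isLocalMin_of_deriv_deriv_pos (by rw [h1]; exact hpos)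
    hmax.deriv_eq_zero hf.self_of_nhds.continuousAt
  have hconst : f =ᶠ[nhds 0] fun _ => f 0 := by
    filter_upwards [hmax, hmin] with t h2 h3
    exact le_antisymm h2 h3
  have h4 : deriv f =ᶠ[nhds 0] deriv (fun _ => f 0) := hconst.deriv
  have h5 := h4.deriv_eq
  simp at h5
  rw [h1] at h5
  linarith

/-- Derivative along a coordinate line. -/
lemma line_deriv (g : E3 → ℝ) (z v : E3) (τ t : ℝ) (hg : DifferentiableAt ℝ g (z + (τ * t) • v)) :
    HasDerivAt (fun t : ℝ => g (z + (τ * t) • v)) (τ * fderiv ℝ g (z + (τ * t) • v) v) t := by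
  have h1 : HasDerivAt (fun t : ℝ => z + (τ * t) • v) (τ • v) t := by
    have := (((hasDerivAt_id t).const_mul τ).smul_const v).const_add z
    simpa using this
  have := hg.hasFDerivAt.comp_hasDerivAt t h1
  refine HasDerivAt.congr_deriv this ?_
  simp

/-- One sided interior gradient bound on a cube. -/
lemma cube_grad_le (u : E3 → ℝ) (U : Set E3) (hU : IsOpen U) (hu : ContDiffOn ℝ 2 u U)
    (y : E3) (d : ℝ) (hd : 0 < d) (hcube : ∀ z : E3, (∀ i, |z i - y i| ≤ d) → z ∈ U)
    (M N : ℝ) (hM : ∀ z ∈ U, |u z| ≤ M)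
    (hN : ∀ z ∈ U, |∑ i : Fin 3, fderiv ℝ (fun w => fderiv ℝ u w (EuclideanSpace.single i 1)) z
      (EuclideanSpace.single i 1)| < N) (k : Fin 3) :
    fderiv ℝ u y (EuclideanSpace.single k 1) ≤ 3 * M / d + d / 2 * N := by
  have hyU : y ∈ U := hcube y (fun i => by simpa using hd.le)
  have hM0 : 0 ≤ M := (abs_nonneg _).trans (hM y hyU)
  have hN0 : 0 < N := (abs_nonneg _).trans_lt (hN y hyU)
  have hdiff : ∀ z ∈ U, DifferentiableAt ℝ u z := fun z hz =>
    (hu.differentiableOn (by norm_num)).differentiableAt (hU.mem_nhds hz)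
  have hdiff2 : ∀ (v : E3), ∀ z ∈ U, DifferentiableAt ℝ (fun w => fderiv ℝ u w v) z := by
    intro v z hz
    have h1 : ContDiffOn ℝ 1 (fderiv ℝ u) U := hu.fderiv_of_isOpen hU (by norm_num)
    exact ((h1.differentiableOn (by norm_num)).differentiableAt (hU.mem_nhds hz)).clm_apply
      (differentiableAt_const v)
  set e : Fin 3 → E3 := fun i => EuclideanSpace.single i 1 with he
  set σ : E3 → E3 := fun z => z + (-2 * (z k - y k)) • e k with hσ
  set ψ : E3 → ℝ := fun z => M / d ^ 2 * ((∑ i, (z i - y i) ^ 2) + 3 * d * (z k - y k)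
    - 3 * (z k - y k) ^ 2) + N / 2 * (d * (z k - y k) - (z k - y k) ^ 2) with hψ
  set F : E3 → ℝ := fun z => 1 / 2 * (u z - u (σ z)) - ψ z with hF
  set H : Set E3 := {z | (∀ i, |z i - y i| ≤ d) ∧ 0 ≤ z k - y k} with hH
  have hσi : ∀ z i, σ z i - y i = if i = k then -(z k - y k) else z i - y i := by
    intro z i
    simp only [hσ, he, PiLp.add_apply, PiLp.smul_apply, EuclideanSpace.single_apply, smul_eq_mul]
    split_ifs with h
    · subst h; ring
    · ring
  have hHU : ∀ z ∈ H, z ∈ U := fun z hz => hcube z hz.1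
  have hσU : ∀ z ∈ H, σ z ∈ U := by
    intro z hz
    refine hcube _ fun i => ?_
    rw [hσi]
    split_ifs with h
    · rw [abs_neg]; exact hz.1 k
    · exact hz.1 i
  have hσc : Continuous σ := by
    simp only [hσ]; fun_prop
  have hψc : Continuous ψ := by
    simp only [hψ]; fun_prop
  have hHcl : IsClosed H := by
    have : H = (⋂ i, {z : E3 | |z i - y i| ≤ d}) ∩ {z : E3 | 0 ≤ z k - y k} := by
      ext z; simp [hH]
    rw [this]
    refine IsClosed.inter (isClosed_iInter fun i => isClosed_le (by fun_prop) (by fun_prop))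
      (isClosed_le (by fun_prop) (by fun_prop))
  have hHb : Bornology.IsBounded H := by
    refine (Metric.isBounded_iff_subset_closedBall y).2 ⟨3 * d, fun z hz => ?_⟩
    rw [mem_closedBall, EuclideanSpace.dist_eq]
    refine Real.sqrt_le_iff.2 ⟨by positivity, ?_⟩
    have h := fun i => sq_le_sq' (abs_le.1 (hz.1 i)).1 (abs_le.1 (hz.1 i)).2
    simp only [Fin.sum_univ_three, Real.dist_eq, sq_abs]
    nlinarith [h 0, h 1, h 2, sq_nonneg d]
  have hHc : IsCompact H := Metric.isCompact_of_isClosed_isBounded hHcl hHb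
  have hyH : y ∈ H := ⟨fun i => by simpa using hd.le, by simp⟩
  have hFc : ContinuousOn F H := by
    have h1 : ContinuousOn u U := hu.continuousOn
    have h2 : ContinuousOn u H := h1.mono hHU
    have h3 : ContinuousOn (fun z => u (σ z)) H := h1.comp hσc.continuousOn hσU
    exact ((h2.sub h3).const_smul (1/2 : ℝ)).sub hψc.continuousOn
  obtain ⟨z, hz, hzmax⟩ := hHc.exists_isMaxOn ⟨y, hyH⟩ hFc
  have hsum_ge : ∀ (z : E3) (i : Fin 3), i ≠ k → (z i - y i) ^ 2 + (z k - y k) ^ 2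
      ≤ ∑ j, (z j - y j) ^ 2 := by
    intro z i hik
    rw [← Finset.sum_pair (f := fun j => (z j - y j) ^ 2) hik]
    exact Finset.sum_le_sum_of_subset_of_nonneg (Finset.subset_univ _) fun _ _ _ => sq_nonneg _
  have hk_ge : ∀ (z : E3), (z k - y k) ^ 2 ≤ ∑ j, (z j - y j) ^ 2 := fun z =>
    Finset.single_le_sum (f := fun j => (z j - y j) ^ 2) (fun _ _ => sq_nonneg _) (Finset.mem_univ k)
  -- the boundary cases
  have hφle : 1 / 2 * (u z - u (σ z)) ≤ M := by
    have h1 := abs_le.1 (hM _ (hHU z hz))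
    have h2 := abs_le.1 (hM _ (hσU z hz))
    linarith
  have hzk1 : z k - y k ≤ d := (abs_le.1 (hz.1 k)).2
  have hψM : d ^ 2 ≤ (∑ i, (z i - y i) ^ 2) + 3 * d * (z k - y k) - 3 * (z k - y k) ^ 2 → M ≤ ψ z := by
    intro h
    have h1 : M / d ^ 2 * d ^ 2 = M := by field_simp
    have h2 := mul_le_mul_of_nonneg_left h (show 0 ≤ M / d ^ 2 by positivity)
    have h3 : 0 ≤ N / 2 * (d * (z k - y k) - (z k - y k) ^ 2) := by
      refine mul_nonneg (by positivity) ?_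
      nlinarith [hz.2]
    simp only [hψ]
    linarith
  have hFz : F z ≤ 0 := by
    by_cases hint : (∀ i, |z i - y i| < d) ∧ 0 < z k - y k
    · exfalso
      -- second derivative test in each direction
      have key : ∀ i : Fin 3, 1 / 2 * (fderiv ℝ (fun w => fderiv ℝ u w (e i)) z (e i)
          - fderiv ℝ (fun w => fderiv ℝ u w (e i)) (σ z) (e i))
          - (M / d ^ 2 * (2 - if i = k then 6 else 0) - if i = k then N else 0) ≤ 0 := by
        intro i
        set κ : ℝ := if i = k then 1 else 0 with hκ
        set τ : ℝ := 1 - 2 * κ with hτ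
        have hcont1 : Filter.Tendsto (fun t : ℝ => z + ((1:ℝ) * t) • e i) (nhds 0) (nhds z) := by
          have : Continuous (fun t : ℝ => z + ((1:ℝ) * t) • e i) := by fun_prop
          simpa using this.tendsto 0
        have hcont2 : Filter.Tendsto (fun t : ℝ => σ z + (τ * t) • e i) (nhds 0) (nhds (σ z)) := by
          have : Continuous (fun t : ℝ => σ z + (τ * t) • e i) := by fun_prop
          simpa using this.tendsto 0
        have hev1 := hcont1.eventually (hU.mem_nhds (hHU z hz))
        have hev2 := hcont2.eventually (hU.mem_nhds (hσU z hz))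
        have hek : ∀ t : ℝ, (z + ((1:ℝ) * t) • e i) k - y k = (z k - y k) + κ * t := by
          intro t
          simp only [he, hκ, PiLp.add_apply, PiLp.smul_apply, EuclideanSpace.single_apply,
            smul_eq_mul, eq_comm (a := k)]
          split_ifs <;> ring
        have hσl : ∀ t : ℝ, σ (z + ((1:ℝ) * t) • e i) = σ z + (τ * t) • e i := by
          intro t
          have h1 := hek t
          simp only [hσ, h1]
          by_cases hik : i = k
          · subst hik
            simp only [hτ, hκ, if_true]
            module
          · simp only [hτ, hκ, if_neg hik]
            module
        have hsq : ∀ t : ℝ, ∑ j, ((z + ((1:ℝ) * t) • e i) j - y j) ^ 2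
            = ∑ j, (z j - y j) ^ 2 + 2 * t * (z i - y i) + t ^ 2 := by
          intro t
          fin_cases i <;> simp [he, Fin.sum_univ_three] <;> ring
        set f : ℝ → ℝ := fun t => F (z + ((1:ℝ) * t) • e i) with hf
        have hfe : ∀ t, f t = 1 / 2 * (u (z + ((1:ℝ) * t) • e i) - u (σ z + (τ * t) • e i))
            - (M / d ^ 2 * ((∑ j, (z j - y j) ^ 2 + 2 * t * (z i - y i) + t ^ 2)
              + 3 * d * ((z k - y k) + κ * t) - 3 * ((z k - y k) + κ * t) ^ 2)
              + N / 2 * (d * ((z k - y k) + κ * t) - ((z k - y k) + κ * t) ^ 2)) := by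
          intro t
          simp only [hf, hF, hψ, hσl, hsq, hek]
        set f' : ℝ → ℝ := fun t => 1 / 2 * (1 * fderiv ℝ u (z + ((1:ℝ) * t) • e i) (e i)
            - τ * fderiv ℝ u (σ z + (τ * t) • e i) (e i))
            - (M / d ^ 2 * ((2 * (z i - y i) + 2 * t)
              + 3 * d * κ - 6 * κ * ((z k - y k) + κ * t))
              + N / 2 * (d * κ - 2 * κ * ((z k - y k) + κ * t))) with hf'
        have hD1 : ∀ᶠ t in nhds (0:ℝ), HasDerivAt f (f' t) t := by
          filter_upwards [hev1, hev2] with t ht1 ht2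
          have h1 := line_deriv u z (e i) 1 t (hdiff _ ht1)
          have h2 := line_deriv u (σ z) (e i) τ t (hdiff _ ht2)
          have hid := hasDerivAt_id t
          have hL : HasDerivAt (fun t : ℝ => (z k - y k) + κ * t) κ t := by
            simpa using (hid.const_mul κ).const_add (z k - y k)
          have hP : HasDerivAt (fun t : ℝ => (∑ j, (z j - y j) ^ 2 + 2 * t * (z i - y i) + t ^ 2))
              (2 * (z i - y i) + 2 * t) t := by
            have := (((hid.const_mul 2).mul_const (z i - y i)).const_add
              (∑ j, (z j - y j) ^ 2)).add (hid.pow 2)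
            refine HasDerivAt.congr_deriv this ?_
            simp
          rw [funext hfe]
          have := ((h1.sub h2).const_mul (1 / 2)).sub
            ((((hP.add (hL.const_mul (3 * d))).sub ((hL.pow 2).const_mul 3)).const_mul (M / d ^ 2)).add
              (((hL.const_mul d).sub (hL.pow 2)).const_mul (N / 2)))
          refine HasDerivAt.congr_deriv this ?_
          simp only [hf']
          norm_num
          ring
        have hD2 : HasDerivAt f' (1 / 2 * (1 * (1 * fderiv ℝ (fun w => fderiv ℝ u w (e i))
            (z + ((1:ℝ) * 0) • e i) (e i))
            - τ * (τ * fderiv ℝ (fun w => fderiv ℝ u w (e i)) (σ z + (τ * 0) • e i) (e i)))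
            - (M / d ^ 2 * (2 - 6 * κ * κ) + N / 2 * (- 2 * κ * κ))) 0 := by
          have h1 := line_deriv (fun w => fderiv ℝ u w (e i)) z (e i) 1 0
            (hdiff2 _ _ (by simpa using hHU z hz))
          have h2 := line_deriv (fun w => fderiv ℝ u w (e i)) (σ z) (e i) τ 0
            (hdiff2 _ _ (by simpa using hσU z hz))
          have hid := hasDerivAt_id (0:ℝ)
          have hL : HasDerivAt (fun t : ℝ => (z k - y k) + κ * t) κ 0 := by
            simpa using (hid.const_mul κ).const_add (z k - y k)
          have hP : HasDerivAt (fun t : ℝ => (2 * (z i - y i) + 2 * t)) 2 0 := by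
            simpa using (hid.const_mul 2).const_add (2 * (z i - y i))
          have := (((h1.const_mul 1).sub (h2.const_mul τ)).const_mul (1 / 2)).sub
            ((((hP.add_const (3 * d * κ)).sub (hL.const_mul (6 * κ))).const_mul (M / d ^ 2)).add
              (((hL.const_mul (2 * κ)).const_sub (d * κ)).const_mul (N / 2)))
          refine HasDerivAt.congr_deriv this ?_
          ring
        have hlm : IsLocalMax f 0 := by
          have hopen : {w : E3 | (∀ i, |w i - y i| < d) ∧ 0 < w k - y k} ∈ nhds z := by
            refine IsOpen.mem_nhds ?_ hint
            have : {w : E3 | (∀ i, |w i - y i| < d) ∧ 0 < w k - y k}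
                = (⋂ i, {z : E3 | |z i - y i| < d}) ∩ {z : E3 | 0 < z k - y k} := by
              ext z; simp
            rw [this]
            exact (isOpen_iInter_of_finite fun i => isOpen_lt (by fun_prop) (by fun_prop)).inter
              (isOpen_lt (by fun_prop) (by fun_prop))
          filter_upwards [hcont1.eventually hopen] with t ht
          have h1 : z + ((1:ℝ) * t) • e i ∈ H := ⟨fun j => (ht.1 j).le, ht.2.le⟩
          have h2 := hzmax h1
          simpa [hf] using h2
        have := second_nonpos f f' _ hD1 hD2 hlm
        simp only [mul_zero, zero_smul, add_zero] at this
        refine le_trans (le_of_eq ?_) this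
        simp only [hτ, hκ]
        split_ifs <;> ring
      have hs := Finset.sum_nonpos (s := Finset.univ) fun i _ => key i
      have h1 := abs_lt.1 (hN _ (hHU z hz))
      have h2 := abs_lt.1 (hN _ (hσU z hz))
      simp only [Finset.sum_sub_distrib, ← Finset.mul_sum, Finset.sum_ite_eq', Finset.mem_univ,
        if_true, Finset.sum_const, Finset.card_univ, Fintype.card_fin] at hs
      norm_num at hs
      have h3 := h1.1
      have h4 := h2.2
      simp only [he] at hs
      linarith
    · rw [not_and_or] at hint
      have hnn := hz.2
      rcases hint with h | h
      · push Not at h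
        obtain ⟨i, hi⟩ := h
        have hsqi : d ^ 2 ≤ (z i - y i) ^ 2 := by
          rw [← sq_abs (z i - y i)]
          exact pow_le_pow_left₀ hd.le hi 2
        have : M ≤ ψ z := by
          apply hψM
          by_cases hik : i = k
          · subst hik
            have := hk_ge z
            have h5 : z i - y i = d := by
              rw [abs_of_nonneg hnn] at hi
              linarith
            rw [h5] at this ⊢
            nlinarith
          · have := hsum_ge z i hik
            nlinarith [mul_nonneg hnn (sub_nonneg.2 hzk1)]
        simp only [hF]
        linarith
      · have h0 : z k - y k = 0 := le_antisymm (not_lt.1 h) hnn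
        have h6 : σ z = z := by simp [hσ, h0]
        simp only [hF, h6, hψ, h0]
        have : 0 ≤ M / d ^ 2 * ∑ i, (z i - y i) ^ 2 := by positivity
        linarith
  -- conclusion
  have hline : ∀ t ∈ Ioo 0 d, u (y + t • e k) - u (y - t • e k) ≤ 2 * t * (3 * M / d + d / 2 * N) := by
    intro t ht
    have hcoord : ∀ i, (y + t • e k) i - y i = if i = k then t else 0 := by
      intro i; simp [he, EuclideanSpace.single_apply]
    have hmem : y + t • e k ∈ H := by
      refine ⟨fun i => ?_, ?_⟩
      · rw [hcoord]; split_ifs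
        · rw [abs_of_pos ht.1]; exact ht.2.le
        · simpa using hd.le
      · rw [hcoord]; simpa using ht.1.le
    have h1 : F (y + t • e k) ≤ 0 := (hzmax hmem).trans hFz
    have h2 : σ (y + t • e k) = y - t • e k := by
      simp only [hσ, hcoord, if_true]; module
    simp only [hF, h2, hψ, hcoord, if_true, ite_pow, Finset.sum_ite_eq', Finset.mem_univ] at h1
    norm_num at h1
    have h3 : M / d ^ 2 * (t ^ 2 + 3 * d * t - 3 * t ^ 2) ≤ t * (3 * M / d) := by
      have : t * (3 * M / d) = M / d ^ 2 * (3 * d * t) := by field_simp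
      rw [this]
      refine mul_le_mul_of_nonneg_left ?_ (by positivity)
      nlinarith [sq_nonneg t]
    have h4 : N / 2 * (d * t - t ^ 2) ≤ t * (d / 2 * N) := by
      nlinarith [mul_nonneg hN0.le (sq_nonneg t)]
    linarith
  have hder : HasDerivAt (fun t : ℝ => u (y + ((1:ℝ) * t) • e k) - u (y + ((-1:ℝ) * t) • e k))
      (2 * fderiv ℝ u y (e k)) 0 := by
    have h1 := line_deriv u y (e k) 1 0 (hdiff _ (by simpa using hyU))
    have h2 := line_deriv u y (e k) (-1) 0 (hdiff _ (by simpa using hyU))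
    refine HasDerivAt.congr_deriv (h1.sub h2) ?_
    simp
    ring
  have hlim := hder.tendsto_slope_zero_right
  have hle : 2 * fderiv ℝ u y (e k) ≤ 2 * (3 * M / d + d / 2 * N) := by
    refine le_of_tendsto hlim ?_
    filter_upwards [Ioo_mem_nhdsGT hd] with t ht
    have h := hline t ht
    have h' : u (y + ((1:ℝ) * (0 + t)) • e k) - u (y + ((-1:ℝ) * (0 + t)) • e k)
        - (u (y + ((1:ℝ) * 0) • e k) - u (y + ((-1:ℝ) * 0) • e k))
        ≤ 2 * t * (3 * M / d + d / 2 * N) := by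
      have e1 : y + ((-1:ℝ) * (0 + t)) • e k = y - t • e k := by module
      rw [e1]
      simpa using h
    rw [smul_eq_mul]
    refine (mul_le_mul_of_nonneg_left h' (inv_nonneg.2 ht.1.le)).trans (le_of_eq ?_)
    have := ht.1.ne'
    field_simp
  linarith

/-- Interior gradient bound on a cube. -/
lemma cube_grad_abs (u : E3 → ℝ) (U : Set E3) (hU : IsOpen U) (hu : ContDiffOn ℝ 2 u U)
    (y : E3) (d : ℝ) (hd : 0 < d) (hcube : ∀ z : E3, (∀ i, |z i - y i| ≤ d) → z ∈ U)
    (M N : ℝ) (hM : ∀ z ∈ U, |u z| ≤ M)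
    (hN : ∀ z ∈ U, |∑ i : Fin 3, fderiv ℝ (fun w => fderiv ℝ u w (EuclideanSpace.single i 1)) z
      (EuclideanSpace.single i 1)| < N) (k : Fin 3) :
    |fderiv ℝ u y (EuclideanSpace.single k 1)| ≤ 3 * M / d + d / 2 * N := by
  refine abs_le.2 ⟨?_, cube_grad_le u U hU hu y d hd hcube M N hM hN k⟩
  have h := cube_grad_le (fun z => - u z) U hU hu.neg y d hd hcube M N
    (by simpa using hM) (by simpa [fderiv_fun_neg, abs_neg, ← neg_add] using hN) k
  simp [fderiv_fun_neg] at h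
  linarith

/-- a priori interior gradient estimate for solutions of the EL equation. -/
theorem stmt4 (a b c : ℝ) (ha : 0 ≤ a) (hb : 0 < b) (hc : 0 < c)
    (M : ℝ) (hM : 0 < M) :
    ∃ C : ℝ, 0 < C ∧
      ∀ ε ∈ Ioo (0 : ℝ) 1, ∀ r : ℝ, 0 < r → ∀ (x : E3) (Q : E3 → M3),
        ContDiffOn ℝ (⊤ : ℕ∞) Q (ball x (2 * r)) →
        (∀ y ∈ ball x (2 * r), Q y ∈ S0) →
        (∀ y ∈ ball x (2 * r), ELeq a b c ε Q y) →
        (∀ y ∈ ball x (2 * r), frobNorm (Q y) ≤ M) →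
        ∀ y ∈ ball x r, Real.sqrt (gradSq Q y) ≤ C * (1 / ε + 1 / r) := by
  set K : ℝ := a * M + b * (3 * M ^ 2) + b / 3 * (9 * M ^ 2) + c * (9 * M ^ 2) * M + 1 with hK
  have hK0 : 0 < K := by positivity
  refine ⟨6 * (6 * M + K), by positivity, ?_⟩
  intro ε hε r hr x Q hQ _ hEL hbd y hy
  have hε0 := hε.1
  set U := ball x (2 * r) with hUdef
  have hU : IsOpen U := isOpen_ball
  have hent : ∀ z ∈ U, ∀ i j, |Q z i j| ≤ M := by
    intro z hz i j
    refine le_trans ?_ (hbd z hz)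
    rw [frobNorm, ← Real.sqrt_sq_eq_abs]
    refine Real.sqrt_le_sqrt ?_
    have h1 : Q z i j ^ 2 ≤ ∑ j', Q z i j' ^ 2 :=
      Finset.single_le_sum (f := fun j' => Q z i j' ^ 2) (fun _ _ => sq_nonneg _) (Finset.mem_univ j)
    have h2 : ∑ j', Q z i j' ^ 2 ≤ ∑ i', ∑ j', Q z i' j' ^ 2 :=
      Finset.single_le_sum (f := fun i' => ∑ j', Q z i' j' ^ 2)
        (fun _ _ => Finset.sum_nonneg fun _ _ => sq_nonneg _) (Finset.mem_univ i)
    exact h1.trans h2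
  have hsqent : ∀ z ∈ U, ∀ i j, |(Q z * Q z) i j| ≤ 3 * M ^ 2 := by
    intro z hz i j
    rw [Matrix.mul_apply]
    refine (Finset.abs_sum_le_sum_abs _ _).trans ?_
    refine (Finset.sum_le_card_nsmul _ _ (M ^ 2) fun l _ => ?_).trans (by simp)
    rw [abs_mul, sq]
    exact mul_le_mul (hent z hz _ _) (hent z hz _ _) (abs_nonneg _) hM.le
  have htr : ∀ z ∈ U, |normSqM (Q z)| ≤ 9 * M ^ 2 := by
    intro z hz
    rw [normSqM, Matrix.trace]
    refine (Finset.abs_sum_le_sum_abs _ _).trans ?_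
    refine (Finset.sum_le_card_nsmul _ _ (3 * M ^ 2) fun l _ => ?_).trans (by simp; linarith)
    exact hsqent z hz _ _
  have hlap : ∀ z ∈ U, ∀ i j, |lapM Q z i j| < K / ε ^ 2 := by
    intro z hz i j
    have h := congrFun (congrFun (hEL z hz) i) j
    simp only [Matrix.add_apply, Matrix.sub_apply, Matrix.smul_apply, smul_eq_mul,
      Matrix.zero_apply] at h
    rw [lt_div_iff₀ (by positivity)]
    have heq : |lapM Q z i j| * ε ^ 2 = |lapM Q z i j * ε ^ 2| := by
      rw [abs_mul, abs_of_pos (show 0 < ε ^ 2 by positivity)]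
    have heq2 : lapM Q z i j * ε ^ 2 = -(a * Q z i j) - b * (Q z * Q z) i j
        + b / 3 * normSqM (Q z) * (1 : M3) i j + c * normSqM (Q z) * Q z i j := by linarith
    have t1 : |a * Q z i j| ≤ a * M := by
      rw [abs_mul, abs_of_nonneg ha]; exact mul_le_mul_of_nonneg_left (hent z hz i j) ha
    have t2 : |b * (Q z * Q z) i j| ≤ b * (3 * M ^ 2) := by
      rw [abs_mul, abs_of_pos hb]; exact mul_le_mul_of_nonneg_left (hsqent z hz i j) hb.le
    have t3 : |b / 3 * normSqM (Q z) * (1 : M3) i j| ≤ b / 3 * (9 * M ^ 2) := by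
      rw [abs_mul, abs_mul, abs_of_pos (show 0 < b / 3 by positivity)]
      have h1 : |(1 : M3) i j| ≤ 1 := by
        rw [Matrix.one_apply]; split_ifs <;> simp
      refine (mul_le_of_le_one_right (by positivity) h1).trans ?_
      exact mul_le_mul_of_nonneg_left (htr z hz) (by positivity)
    have t4 : |c * normSqM (Q z) * Q z i j| ≤ c * (9 * M ^ 2) * M := by
      rw [abs_mul, abs_mul, abs_of_pos hc]
      exact mul_le_mul (mul_le_mul_of_nonneg_left (htr z hz) hc.le) (hent z hz i j)
        (abs_nonneg _) (by positivity)
    rw [heq, heq2, abs_lt]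
    rw [abs_le] at t1 t2 t3 t4
    constructor <;> linarith [t1.1, t1.2, t2.1, t2.2, t3.1, t3.2, t4.1, t4.2]
  set d : ℝ := min ε r / 2 with hd
  have hd0 : 0 < d := by have := lt_min hε0 hr; positivity
  have hdε : d ≤ ε / 2 := by have := min_le_left ε r; linarith
  have hdr : d ≤ r / 2 := by have := min_le_right ε r; linarith
  have hdinv : 1 / d ≤ 2 * (1 / ε + 1 / r) := by
    have p1 : 0 < 1 / ε := by positivity
    have p2 : 0 < 1 / r := by positivity
    rcases min_cases ε r with h | h
    · rw [hd, h.1]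
      have : 1 / (ε / 2) = 2 * (1 / ε) := by field_simp
      linarith
    · rw [hd, h.1]
      have : 1 / (r / 2) = 2 * (1 / r) := by field_simp
      linarith
  have hcube : ∀ z : E3, (∀ i, |z i - y i| ≤ d) → z ∈ U := by
    intro z hz
    have h1 : dist z y < r := by
      rw [EuclideanSpace.dist_eq, Real.sqrt_lt' hr]
      have h := fun i => sq_le_sq' (abs_le.1 (hz i)).1 (abs_le.1 (hz i)).2
      simp only [Fin.sum_univ_three, Real.dist_eq, sq_abs]
      nlinarith [h 0, h 1, h 2]
    have h2 := dist_triangle z y x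
    rw [mem_ball] at hy
    rw [hUdef, mem_ball]
    linarith
  set B : ℝ := (6 * M + K) * (1 / ε + 1 / r) with hB
  have hB0 : 0 < B := by positivity
  have hpd : ∀ k i j, |pd Q k y i j| ≤ B := by
    intro k i j
    have hu : ContDiffOn ℝ 2 (fun z => Q z i j) U := by
      have h1 : ContDiffOn ℝ 2 Q U := hQ.of_le (WithTop.coe_le_coe.2 (le_top : (2 : ℕ∞) ≤ ⊤))
      have h2 := contDiffOn_pi.1 h1 i
      exact contDiffOn_pi.1 h2 j
    have h := cube_grad_abs (fun z => Q z i j) U hU hu y d hd0 hcube M (K / ε ^ 2)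
      (fun z hz => hent z hz i j) (fun z hz => by
        have := hlap z hz i j
        simpa [lapM, pd, Matrix.sum_apply] using this) k
    refine h.trans ?_
    have p2 : 0 < 1 / r := by positivity
    have q1 : 3 * M / d ≤ 6 * M * (1 / ε + 1 / r) := by
      have := mul_le_mul_of_nonneg_left hdinv (show 0 ≤ 3 * M by positivity)
      calc 3 * M / d = 3 * M * (1 / d) := by ring
        _ ≤ _ := this
        _ = _ := by ring
    have q2 : d / 2 * (K / ε ^ 2) ≤ K * (1 / ε + 1 / r) := by
      have s1 : d / 2 * (K / ε ^ 2) ≤ ε * (K / ε ^ 2) :=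
        mul_le_mul_of_nonneg_right (by linarith) (by positivity)
      have s2 : ε * (K / ε ^ 2) = K * (1 / ε) := by field_simp
      have s3 : 0 < K * (1 / r) := by positivity
      linarith
    rw [hB]; linarith
  refine Real.sqrt_le_iff.2 ⟨by positivity, ?_⟩
  have hsq : ∀ k i j, (pd Q k y i j) ^ 2 ≤ B ^ 2 := fun k i j =>
    sq_le_sq' (abs_le.1 (hpd k i j)).1 (abs_le.1 (hpd k i j)).2
  have hsum : gradSq Q y ≤ 27 * B ^ 2 := by
    have : gradSq Q y ≤ ∑ _k : Fin 3, ∑ _i : Fin 3, ∑ _j : Fin 3, B ^ 2 :=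
      Finset.sum_le_sum fun k _ => Finset.sum_le_sum fun i _ => Finset.sum_le_sum fun j _ => hsq k i j
    simp at this
    linarith
  have : 6 * (6 * M + K) * (1 / ε + 1 / r) = 6 * B := by rw [hB]; ring
  rw [this]
  nlinarith [sq_nonneg B]

end
end
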